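/- arXiv:1409.0063 — 5 statements merged into one kernel-verified Lean document; each statement's English description precedes it below -/
import Mathlib

section
/- Let m, n be coprime positive integers with m ≥ 2, n/m > 1, and n dividing (m−1)², and set l = gcd(n, m−1). If there exists an ascending k-stair packing polynomial on S(n/m), then k divides l. -/
/-- The set of lattice points `I(n/m)` of the sector
`S(n/m) = {(x,y) : x ≥ 0, y ≥ 0, y ≤ (n/m)·x}`, described by `m·y ≤ n·x`. -/
def sectorLattice (n m : ℤ) : Set (ℤ × ℤ) :=
  {P : ℤ × ℤ | 0 ≤ P.1 ∧ 0 ≤ P.2 ∧ m * P.2 ≤ n * P.1}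

/-- The sector `S(n/m)` in the real plane. -/
def sectorR (n m : ℤ) : Set (ℝ × ℝ) :=
  {P : ℝ × ℝ | 0 ≤ P.1 ∧ 0 ≤ P.2 ∧ (m : ℝ) * P.2 ≤ (n : ℝ) * P.1}

/-- `p` is a packing polynomial on the region whose lattice points are `I`:
the restriction of `p` to `I` is a bijection from `I` onto `ℕ`. -/
def IsPackingPolyOn (p : ℝ → ℝ → ℝ) (I : Set (ℤ × ℤ)) : Prop :=
  (∀ P ∈ I, ∃ j : ℕ, p P.1 P.2 = j) ∧
  Set.InjOn (fun P : ℤ × ℤ => p P.1 P.2) I ∧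
  (∀ j : ℕ, ∃ P ∈ I, p P.1 P.2 = j)

/-- The `c`-th staircase `S_c` of `I(n/m)`: lattice points of the sector on the line
`y = (n/(m−1))·x − c·l/(m−1)`, i.e. `(m−1)·y = n·x − c·l`, where `l = gcd(n, m−1)`. -/
def staircase (n m : ℤ) (c : ℕ) : Set (ℤ × ℤ) :=
  {P : ℤ × ℤ | P ∈ sectorLattice n m ∧
    (m - 1) * P.2 = n * P.1 - (c : ℤ) * (Int.gcd n (m - 1) : ℤ)}

/-- Two stairs `r`, `s` are consecutive: they lie on a common staircase, are distinct,
and no stair of that staircase lies strictly between them on the segment from `r` to `s`. -/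
def ConsecutiveStairs (n m : ℤ) (r s : ℤ × ℤ) : Prop :=
  ∃ c : ℕ, r ∈ staircase n m c ∧ s ∈ staircase n m c ∧ r ≠ s ∧
    ∀ t ∈ staircase n m c, ¬(min r.1 s.1 < t.1 ∧ t.1 < max r.1 s.1)

/-- `P` is the first stair on the `c`-th staircase: the stair with minimal `x`-coordinate. -/
def IsFirstStair (n m : ℤ) (c : ℕ) (P : ℤ × ℤ) : Prop :=
  P ∈ staircase n m c ∧ ∀ Q ∈ staircase n m c, P.1 ≤ Q.1

/-- `p` is a quadratic polynomial whose homogeneous quadratic part is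
`(n/2)·(x − ((m−1)/n)·y)²`. -/
def HasQuadPart (n m : ℤ) (p : ℝ → ℝ → ℝ) : Prop :=
  ∃ d e f : ℝ, ∀ x y : ℝ,
    p x y = (n : ℝ) / 2 * (x - ((m : ℝ) - 1) / (n : ℝ) * y) ^ 2 + d * x + e * y + f

/-- `p(ℤ²) ⊆ ℤ`. -/
def IntValued (p : ℝ → ℝ → ℝ) : Prop :=
  ∀ a b : ℤ, ∃ z : ℤ, p a b = z

/-- `p` is a `k`-stair polynomial on `S(n/m)`: a quadratic polynomial with quadratic part
`(n/2)(x − ((m−1)/n)y)²`, integer-valued on `ℤ²`, whose values at consecutive stairs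
differ by `±k`. -/
def IsKStair (n m : ℤ) (k : ℕ) (p : ℝ → ℝ → ℝ) : Prop :=
  HasQuadPart n m p ∧ IntValued p ∧
  ∀ r s : ℤ × ℤ, ConsecutiveStairs n m r s →
    p r.1 r.2 - p s.1 s.2 = (k : ℝ) ∨ p r.1 r.2 - p s.1 s.2 = -(k : ℝ)

/-- An ascending `k`-stair polynomial: for consecutive stairs `r`, `s` with `|r| < |s|`,
`p(s) − p(r) = k`. -/
def IsAscendingKStair (n m : ℤ) (k : ℕ) (p : ℝ → ℝ → ℝ) : Prop :=
  IsKStair n m k p ∧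
  ∀ r s : ℤ × ℤ, ConsecutiveStairs n m r s →
    r.1 ^ 2 + r.2 ^ 2 < s.1 ^ 2 + s.2 ^ 2 → p s.1 s.2 - p r.1 r.2 = (k : ℝ)

/-- A descending `k`-stair polynomial: for consecutive stairs `r`, `s` with `|r| < |s|`,
`p(s) − p(r) = −k`. -/
def IsDescendingKStair (n m : ℤ) (k : ℕ) (p : ℝ → ℝ → ℝ) : Prop :=
  IsKStair n m k p ∧
  ∀ r s : ℤ × ℤ, ConsecutiveStairs n m r s →
    r.1 ^ 2 + r.2 ^ 2 < s.1 ^ 2 + s.2 ^ 2 → p s.1 s.2 - p r.1 r.2 = -(k : ℝ)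

/-- Existence of the first stair. -/
lemma aux_first (a b : ℤ) (ha : 0 < a) (hab : IsCoprime a b) (c : ℤ) :
    ∃ x y : ℤ, 0 ≤ y ∧ y < a ∧ a * x = c + b * y := by
  obtain ⟨u, v, huv⟩ := hab
  have h1 := Int.emod_add_mul_ediv (-(c * v)) a
  refine ⟨c * u - b * ((-(c * v)) / a), (-(c * v)) % a, Int.emod_nonneg _ ha.ne',
    Int.emod_lt_of_pos _ ha, ?_⟩
  have h2 : (-(c * v)) % a = -(c*v) - a * ((-(c * v)) / a) := by linarith
  rw [h2]
  linear_combination c * huv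

/-- Uniqueness of the residue. -/
lemma aux_unique (a b : ℤ) (hab : IsCoprime a b) (c y z : ℤ) (hy : 0 ≤ y) (hya : y < a)
    (hz : 0 ≤ z) (hza : z < a) (h1 : a ∣ c + b * y) (h2 : a ∣ c + b * z) : y = z := by
  have h3 : a ∣ b * (y - z) := by
    have := dvd_sub h1 h2
    have e : b * (y - z) = c + b * y - (c + b * z) := by ring
    rwa [e]
  have h4 : a ∣ y - z := hab.dvd_of_dvd_mul_left h3
  have h5 : y - z = 0 := Int.eq_zero_of_abs_lt_dvd h4 (by rw [abs_lt]; constructor <;> linarith)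
  linarith

lemma aux_step (A D k c h e : ℤ) (hA : 0 < A) (hk : 0 < k) (hc : 0 ≤ c + h)
    (hbig : 10 * (k + 1) * (|D| + A * (k + 1) + A) + 10 < c)
    (he1 : -(2 * k * A) ≤ e) (he2 : e ≤ 4 * k * A)
    (heq : h * (A * (2 * c + h) + D) = 2 * k * A * c + e) : h = k := by
  have hD1 : D ≤ |D| := le_abs_self D
  have hD2 : -|D| ≤ D := neg_abs_le D
  have hD0 : 0 ≤ |D| := abs_nonneg D
  set d := |D| with hd
  clear_value d
  have hAA : A ≤ A * (k+1) := by nlinarith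
  have hkk : d + A * (k + 1) + A ≤ (k + 1) * (d + A * (k + 1) + A) := by nlinarith
  have hAk : 0 ≤ A * k := by positivity
  have hcpos : 0 < c := by nlinarith
  have hAc : c ≤ A * c := by nlinarith
  have hA1 : (k + 1) * A ≤ (k+1) * (d + A * (k + 1) + A) := by
    apply mul_le_mul_of_nonneg_left _ (by linarith); linarith
  have hA2 : (k + 1) * d ≤ (k+1) * (d + A * (k + 1) + A) := by
    apply mul_le_mul_of_nonneg_left _ (by linarith); linarith
  have hA3 : (k + 1) * (A * (k+1)) ≤ (k+1) * (d + A * (k + 1) + A) := by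
    apply mul_le_mul_of_nonneg_left _ (by linarith); linarith
  have hrpos : 0 < 2 * k * A * c + e := by
    have : k * A * 10 ≤ k * A * c := by
      apply mul_le_mul_of_nonneg_left _ (by positivity); linarith
    have : 0 < k * A := by positivity
    linarith
  have hf : 0 < A * (2 * c + h) + D := by
    have : A * c ≤ A * (2 * c + h) := mul_le_mul_of_nonneg_left (by linarith) hA.le
    linarith
  have hh : 0 < h := by
    by_contra hcon
    have : h * (A * (2 * c + h) + D) ≤ 0 := mul_nonpos_of_nonpos_of_nonneg (by linarith) hf.le
    linarith
  rcases lt_trichotomy h k with hlt | heq' | hgt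
  · exfalso
    have h1 : h * (A * (2 * c + h) + D) ≤ (k - 1) * (A * (2 * c + h) + D) :=
      mul_le_mul_of_nonneg_right (by linarith) hf.le
    have h2 : A * h ≤ A * k := mul_le_mul_of_nonneg_left hlt.le hA.le
    have h3 : (k - 1) * (A * (2 * c + h) + D) ≤ (k - 1) * (2 * (A * c) + A * k + d) :=
      mul_le_mul_of_nonneg_left (by linarith) (by linarith)
    nlinarith
  · exact heq'
  · exfalso
    have h1 : (k + 1) * (A * (2 * c + h) + D) ≤ h * (A * (2 * c + h) + D) :=
      mul_le_mul_of_nonneg_right (by linarith) hf.le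
    have h2 : 0 ≤ A * h := by positivity
    have h3 : (k + 1) * (2 * (A * c) - d) ≤ (k + 1) * (A * (2 * c + h) + D) :=
      mul_le_mul_of_nonneg_left (by linarith) (by linarith)
    nlinarith

lemma aux_sum (k : ℕ) : 6 * ∑ c ∈ Finset.range k, ((c : ℤ) * (k - c)) = k * (k ^ 2 - 1) := by
  have h : ∀ j : ℕ, ∀ K : ℤ, 6 * ∑ c ∈ Finset.range j, ((c : ℤ) * (K - c))
      = j * (j - 1) * (3 * K - (2 * j - 1)) := by
    intro j K
    induction j with
    | zero => simp
    | succ j ih => rw [Finset.sum_range_succ, mul_add, ih]; push_cast; ring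
  rw [h]; ring

/-- The final arithmetic. -/
lemma aux_final (a t F : ℤ) (k : ℕ) (ht : 0 < t) (hk : 0 < k)
    (hak : IsCoprime a (k : ℤ)) (Y w u : ℕ → ℤ)
    (hY1 : ∀ c, 0 ≤ Y c) (hY2 : ∀ c, Y c < a)
    (hw : ∀ c, a * w c = c + k * Y c)
    (hu : ∀ c : ℕ, 2 * u c = t * c * (c - k) + 2 * w c + 2 * F)
    (hsurj : ∀ v : ℤ, 0 ≤ v → v < k → ∃ c, c < k ∧ u c = v) : (k : ℤ) ∣ t := by
  have ha : 0 < a := lt_of_le_of_lt (hY1 0) (hY2 0)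
  have hkZ : (0 : ℤ) < k := by exact_mod_cast hk
  set R : Finset ℤ := Finset.Ico (0 : ℤ) k with hR
  have hRc : R.card = k := by simp [hR]
  have hsub : R ⊆ (Finset.range k).image u := by
    intro v hv
    rw [hR, Finset.mem_Ico] at hv
    obtain ⟨c, hc, rfl⟩ := hsurj v hv.1 hv.2
    exact Finset.mem_image_of_mem _ (Finset.mem_range.2 hc)
  have himc : ((Finset.range k).image u).card ≤ R.card := by
    rw [hRc]; exact Finset.card_image_le.trans (by simp)
  have him : R = (Finset.range k).image u := Finset.eq_of_subset_of_card_le hsub himc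
  have hinj : Set.InjOn u (Finset.range k) := by
    apply Finset.card_image_iff.1
    rw [← him, hRc]; simp
  have hsu : ∑ c ∈ Finset.range k, u c = ∑ v ∈ R, v := by
    rw [him, Finset.sum_image hinj]
  have huR : ∀ c, c < k → 0 ≤ u c ∧ u c < k := by
    intro c hc
    have : u c ∈ R := by rw [him]; exact Finset.mem_image_of_mem _ (Finset.mem_range.2 hc)
    rwa [hR, Finset.mem_Ico] at this
  have hwinj : Set.InjOn w (Finset.range k) := by
    intro c hc c' hc' h
    have e1 := hw c
    have e2 := hw c'
    rw [h] at e1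
    simp only [Finset.coe_range, Set.mem_Iio] at hc hc'
    have h3 : (k : ℤ) ∣ (c : ℤ) - c' := ⟨Y c' - Y c, by linear_combination e2 - e1⟩
    have h5 : (c : ℤ) - c' = 0 :=
      Int.eq_zero_of_abs_lt_dvd h3 (by rw [abs_lt]; constructor <;> omega)
    omega
  have hwsub : (Finset.range k).image w ⊆ R := by
    intro v hv
    rw [Finset.mem_image] at hv
    obtain ⟨c, hc, rfl⟩ := hv
    rw [Finset.mem_range] at hc
    have hcZ : (c : ℤ) + 1 ≤ k := by exact_mod_cast hc
    have e1 := hw c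
    have y1 := hY1 c
    have y2 := hY2 c
    rw [hR, Finset.mem_Ico]
    constructor
    · have : 0 ≤ a * w c := by rw [e1]; positivity
      exact nonneg_of_mul_nonneg_right this ha
    · have : a * w c < a * k := by rw [e1]; nlinarith
      exact lt_of_mul_lt_mul_left this ha.le
  have hwim : (Finset.range k).image w = R := by
    apply Finset.eq_of_subset_of_card_le hwsub
    rw [Finset.card_image_iff.2 hwinj, hRc]; simp
  have hsw : ∑ c ∈ Finset.range k, w c = ∑ v ∈ R, v := by
    rw [← hwim, Finset.sum_image hwinj]
  have hsum : 2 * ∑ c ∈ Finset.range k, u c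
      = -t * (∑ c ∈ Finset.range k, ((c : ℤ) * (k - c))) + 2 * ∑ c ∈ Finset.range k, w c
        + 2 * k * F := by
    have : ∑ c ∈ Finset.range k, (2 * F) = 2 * k * F := by
      rw [Finset.sum_const, Finset.card_range]; simp; ring
    rw [← this, Finset.mul_sum, Finset.mul_sum, Finset.mul_sum, ← Finset.sum_add_distrib,
      ← Finset.sum_add_distrib]
    apply Finset.sum_congr rfl
    intro c _
    rw [hu c]; ring
  have hF : 12 * F = t * ((k : ℤ) ^ 2 - 1) := by
    have e := aux_sum k
    rw [hsu, hsw] at hsum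
    have : (k : ℤ) * (12 * F) = k * (t * ((k : ℤ) ^ 2 - 1)) := by
      linear_combination t * e - 6 * hsum
    exact mul_left_cancel₀ hkZ.ne' this
  have hu0 : u 0 = F := by
    have e1 := hw 0
    have e2 := hu 0
    have hw0 := huR 0 hk
    have y1 := hY1 0
    have : w 0 = 0 := by
      have : w 0 ∈ R := by
        rw [← hwim]; exact Finset.mem_image_of_mem _ (Finset.mem_range.2 hk)
      rw [hR, Finset.mem_Ico] at this
      have hd : (k : ℤ) ∣ a * w 0 := ⟨Y 0, by rw [e1]; simp⟩
      have hd2 : (k : ℤ) ∣ w 0 := hak.symm.dvd_of_dvd_mul_left hd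
      exact Int.eq_zero_of_dvd_of_nonneg_of_lt this.1 this.2 hd2
    rw [this] at e2
    simp at e2
    linarith
  rcases Nat.lt_or_ge 1 k with hk1 | hk1
  swap
  · have : k = 1 := by omega
    subst this; simp
  have hk1Z : (2 : ℤ) ≤ k := by exact_mod_cast hk1
  have hFk := (huR 0 hk).2
  rw [hu0] at hFk
  have hprod : t * (k + 1) ≤ 12 := by
    have : ((k : ℤ) - 1) * (t * (k + 1)) ≤ (k - 1) * 12 := by
      have : ((k : ℤ) - 1) * (t * (k + 1)) = 12 * F := by rw [hF]; ring
      linarith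
    exact le_of_mul_le_mul_left this (by linarith)
  have hpar := hu 1
  have hcol : ∀ c : ℕ, 0 < c → c < k → IsCoprime (2 : ℤ) k → ¬ ((k : ℤ) ∣ 2 + a * t * c) := by
    intro c hc0 hck h2 hdv
    have e1 := hw c
    have e2 := hu c
    have hd : (k : ℤ) ∣ 2 * (a * (u c - u 0)) := by
      obtain ⟨q, hq⟩ := hdv
      refine ⟨c * q - a * t * c + 2 * Y c, ?_⟩
      rw [hu0]
      linear_combination a * e2 + 2 * e1 + c * hq
    have hd2 := hak.symm.dvd_of_dvd_mul_left (h2.symm.dvd_of_dvd_mul_left hd)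
    have b1 := huR c hck
    have b0 := huR 0 hk
    have h5 : u c - u 0 = 0 :=
      Int.eq_zero_of_abs_lt_dvd hd2 (by rw [abs_lt]; constructor <;> linarith)
    have := hinj (Finset.mem_coe.2 (Finset.mem_range.2 hck))
      (Finset.mem_coe.2 (Finset.mem_range.2 hk)) (by linarith : u c = u 0)
    omega
  have hkle : k ≤ 11 := by
    have : (k : ℤ) + 1 ≤ t * (k + 1) := by nlinarith
    omega
  have ht4 : t ≤ 4 := by nlinarith
  have hna : ¬ ((k : ℤ) ∣ a) := by
    intro h
    have : IsUnit (k : ℤ) := hak.isUnit_of_dvd' h dvd_rfl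
    rw [Int.isUnit_iff] at this
    omega
  clear_value R
  clear hsum hsw hsu him hwim hwinj hinj hsub himc hwsub hRc hR
  interval_cases t <;> interval_cases k <;> first
    | (exfalso; omega)
    | norm_num
  · have h := fun c h1 h2 => hcol c h1 h2 ⟨-2, 1, by norm_num⟩
    have h1 := h 1 (by norm_num) (by norm_num)
    have h2 := h 2 (by norm_num) (by norm_num)
    have h3 := h 3 (by norm_num) (by norm_num)
    have h4 := h 4 (by norm_num) (by norm_num)
    clear * - h1 h2 h3 h4 hna
    push_cast at *
    have hr : a % 5 = 1 ∨ a % 5 = 2 ∨ a % 5 = 3 ∨ a % 5 = 4 := by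
      omega
    rcases hr with hr | hr | hr | hr <;> omega
  · have h := fun c h1 h2 => hcol c h1 h2 ⟨-3, 1, by norm_num⟩
    have h1 := h 1 (by norm_num) (by norm_num)
    have h2 := h 2 (by norm_num) (by norm_num)
    have h3 := h 3 (by norm_num) (by norm_num)
    have h4 := h 4 (by norm_num) (by norm_num)
    have h5 := h 5 (by norm_num) (by norm_num)
    have h6 := h 6 (by norm_num) (by norm_num)
    clear * - h1 h2 h3 h4 h5 h6 hna
    push_cast at *
    have hr : a % 7 = 1 ∨ a % 7 = 2 ∨ a % 7 = 3 ∨ a % 7 = 4 ∨ a % 7 = 5 ∨ a % 7 = 6 := by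
      omega
    rcases hr with hr | hr | hr | hr | hr | hr <;> omega
  · have h := fun c h1 h2 => hcol c h1 h2 ⟨-5, 1, by norm_num⟩
    have h1 := h 1 (by norm_num) (by norm_num)
    have h2 := h 2 (by norm_num) (by norm_num)
    have h3 := h 3 (by norm_num) (by norm_num)
    have h4 := h 4 (by norm_num) (by norm_num)
    have h5 := h 5 (by norm_num) (by norm_num)
    have h6 := h 6 (by norm_num) (by norm_num)
    have h7 := h 7 (by norm_num) (by norm_num)
    have h8 := h 8 (by norm_num) (by norm_num)
    have h9 := h 9 (by norm_num) (by norm_num)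
    have h10 := h 10 (by norm_num) (by norm_num)
    clear * - h1 h2 h3 h4 h5 h6 h7 h8 h9 h10 hna
    push_cast at *
    have hr : a % 11 = 1 ∨ a % 11 = 2 ∨ a % 11 = 3 ∨ a % 11 = 4 ∨ a % 11 = 5 ∨ a % 11 = 6 ∨ a % 11 = 7 ∨ a % 11 = 8 ∨ a % 11 = 9 ∨ a % 11 = 10 := by
      omega
    rcases hr with hr | hr | hr | hr | hr | hr | hr | hr | hr | hr <;> omega
  · have h := fun c h1 h2 => hcol c h1 h2 ⟨-2, 1, by norm_num⟩
    have h1 := h 1 (by norm_num) (by norm_num)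
    have h2 := h 2 (by norm_num) (by norm_num)
    have h3 := h 3 (by norm_num) (by norm_num)
    have h4 := h 4 (by norm_num) (by norm_num)
    clear * - h1 h2 h3 h4 hna
    push_cast at *
    have hr : a % 5 = 1 ∨ a % 5 = 2 ∨ a % 5 = 3 ∨ a % 5 = 4 := by
      omega
    rcases hr with hr | hr | hr | hr <;> omega

/-- The integral core of the argument. -/
lemma aux_core (a b t D E F : ℤ) (k : ℕ) (ha : 1 < a) (ht : 0 < t) (hb : 0 < b)
    (hab : IsCoprime a b) (hDE : D * b + E * a = 2 * k) (Q : ℤ → ℤ → ℤ)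
    (hQ : ∀ x y, 2 * Q x y = t * (a * x - b * y) ^ 2 + D * x + E * y + 2 * F)
    (hnn : ∀ x y, 0 ≤ y → y ≤ a * t * (a * x - b * y) → 0 ≤ Q x y)
    (hinj : ∀ x y x' y', 0 ≤ y → y ≤ a * t * (a * x - b * y) →
      0 ≤ y' → y' ≤ a * t * (a * x' - b * y') → Q x y = Q x' y' → x = x' ∧ y = y')
    (hsurj : ∀ v : ℤ, 0 ≤ v → ∃ x y, 0 ≤ y ∧ y ≤ a * t * (a * x - b * y) ∧ Q x y = v) :
    (k : ℤ) ∣ t := by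
  have ha0 : 0 < a := by linarith
  have hat : 0 < a * t := by positivity
  -- k is positive
  have hk : 0 < k := by
    rcases Nat.eq_zero_or_pos k with h | h
    · exfalso
      subst h
      have e : Q 1 0 = Q (1 + b) a := by
        have e1 := hQ 1 0
        have e2 := hQ (1 + b) a
        push_cast at hDE
        have : 2 * Q 1 0 = 2 * Q (1 + b) a := by
          rw [e1, e2]; linear_combination -hDE
        linarith
      have := (hinj 1 0 (1 + b) a le_rfl (by nlinarith) ha0.le (by nlinarith) e).2
      linarith
    · exact h
  have hkZ : (0 : ℤ) < k := by exact_mod_cast hk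
  choose X Y hY1 hY2 hXY using aux_first a b ha0 hab
  have huniq : ∀ c y, 0 ≤ y → y < a → a ∣ c + b * y → Y c = y := fun c y h1 h2 h3 =>
    aux_unique a b hab c (Y c) y (hY1 c) (hY2 c) h1 h2 ⟨X c, (hXY c).symm⟩ h3
  set N : ℤ → ℤ := fun c => t * c + (if Y c = 0 then 1 else 0) with hN
  have hNiff : ∀ c j, Y c + a * j ≤ a * t * c ↔ j < N c := by
    intro c j
    have y1 := hY1 c
    have y2 := hY2 c
    simp only [hN]
    split_ifs with h0
    · rw [h0, zero_add, mul_assoc, mul_le_mul_iff_right₀ ha0]; omega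
    · constructor
      · intro h
        have : a * j < a * (t * c) := by
          have : 0 < Y c := by omega
          linarith
        have := lt_of_mul_lt_mul_left this ha0.le
        omega
      · intro h
        have : a * (j + 1) ≤ a * (t * c) := mul_le_mul_of_nonneg_left (by omega) ha0.le
        linarith
  have hY0 : ∀ c, a ∣ c → Y c = 0 := fun c h => huniq c 0 le_rfl ha0 (by simpa using h)
  have hNpos : ∀ c, 0 ≤ c → 0 < N c := by
    intro c hc
    simp only [hN]
    rcases hc.eq_or_lt with h | h
    · subst h
      rw [hY0 0 (dvd_zero a)]; simp
    · have : 0 < t * c := by positivity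
      split_ifs <;> linarith
  set W : ℤ → ℤ := fun c => Q (X c) (Y c) with hW
  have hWj : ∀ c j, Q (X c + b * j) (Y c + a * j) = W c + k * j := by
    intro c j
    have e1 := hQ (X c) (Y c)
    have e2 := hQ (X c + b * j) (Y c + a * j)
    have : 2 * Q (X c + b * j) (Y c + a * j) = 2 * (W c + k * j) := by
      simp only [hW]
      linear_combination e2 - e1 + j * hDE
    linarith
  have hcc : ∀ c j, a * (X c + b * j) - b * (Y c + a * j) = c := by
    intro c j
    linear_combination hXY c
  have haW : ∀ c, 2 * a * W c = a * t * c ^ 2 + D * c + 2 * k * Y c + 2 * a * F := by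
    intro c
    have e1 := hQ (X c) (Y c)
    have e2 : a * X c - b * Y c = c := by linear_combination hXY c
    rw [e2] at e1
    simp only [hW]
    linear_combination a * e1 + D * hXY c + Y c * hDE
  -- representation of lattice points
  have hrep : ∀ x y, 0 ≤ y → y ≤ a * t * (a * x - b * y) →
      ∃ c j, 0 ≤ c ∧ 0 ≤ j ∧ j < N c ∧ x = X c + b * j ∧ y = Y c + a * j := by
    intro x y hy hyx
    have h1 := Int.emod_add_mul_ediv y a
    have hYe : Y (a * x - b * y) = y % a := by
      apply huniq _ _ (Int.emod_nonneg _ ha0.ne') (Int.emod_lt_of_pos _ ha0)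
      refine ⟨x - b * (y / a), ?_⟩
      linear_combination b * h1
    have hye : y = Y (a * x - b * y) + a * (y / a) := by rw [hYe]; exact h1.symm
    refine ⟨a * x - b * y, y / a, ?_, Int.ediv_nonneg hy ha0.le, ?_, ?_, hye⟩
    · exact nonneg_of_mul_nonneg_right (hy.trans hyx) hat
    · rw [← hNiff, ← hye]; exact hyx
    · have e := hXY (a * x - b * y)
      have : a * x = a * (X (a * x - b * y) + b * (y / a)) := by
        rw [mul_add, e]
        linear_combination b * hye
      exact mul_left_cancel₀ ha0.ne' this
  have hnn' : ∀ c, 0 ≤ c → 0 ≤ W c := by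
    intro c hc
    have e := hcc c 0
    simp only [mul_zero, add_zero] at e
    have h := (hNiff c 0).2 (hNpos c hc)
    simp only [mul_zero, add_zero] at h
    exact hnn _ _ (hY1 c) (by rw [e]; exact h)
  have hsurj' : ∀ v, 0 ≤ v → ∃ c j, 0 ≤ c ∧ 0 ≤ j ∧ j < N c ∧ W c + k * j = v := by
    intro v hv
    obtain ⟨x, y, h1, h2, h3⟩ := hsurj v hv
    obtain ⟨c, j, hc, hj, hjN, hx, hy⟩ := hrep x y h1 h2
    refine ⟨c, j, hc, hj, hjN, ?_⟩
    rw [← hWj, ← hx, ← hy, h3]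
  have hinj' : ∀ c j c' j', 0 ≤ j → j < N c → 0 ≤ j' → j' < N c' →
      W c + k * j = W c' + k * j' → c = c' ∧ j = j' := by
    intro c j c' j' hj hjN hj' hjN' h
    rw [← hWj, ← hWj] at h
    have y1 := hY1 c
    have y1' := hY1 c'
    obtain ⟨hx, hy⟩ := hinj _ _ _ _ (by positivity) (by rw [hcc, hNiff]; exact hjN)
      (by positivity) (by rw [hcc, hNiff]; exact hjN') h
    have ec : c = c' := by
      rw [← hcc c j, ← hcc c' j', hx, hy]
    subst ec
    refine ⟨rfl, ?_⟩
    exact mul_left_cancel₀ ha0.ne' (by linarith)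
  -- successor
  have hsucc : ∀ c, 0 ≤ c → ∃ c', 0 ≤ c' ∧ W c' = W c + k * N c := by
    intro c hc
    have hp := hNpos c hc
    have hw := hnn' c hc
    obtain ⟨c', j, hc', hj, hjN, h⟩ := hsurj' (W c + k * N c) (by positivity)
    rcases hj.eq_or_lt with h0 | h0
    · subst h0
      exact ⟨c', hc', by linarith⟩
    · exfalso
      obtain ⟨e1, e2⟩ := hinj' c' (j - 1) c (N c - 1) (by omega) (by omega) (by omega) (by omega)
        (by linear_combination h)
      subst e1
      omega
  -- large staircases
  set B : ℤ := 10 * (k + 1) * (|D| + a * t * (k + 1) + a * t) + 10 with hB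
  have hB0 : 0 < B := by positivity
  have hlarge : ∀ c, B < c → W (c + k) = W c + k * N c := by
    intro c hc
    obtain ⟨c', hc', h⟩ := hsucc c (by linarith)
    have e1 := haW c
    have e2 := haW c'
    have y1 := hY1 c
    have y2 := hY2 c
    have y1' := hY1 c'
    have y2' := hY2 c'
    have hh : c' - c = k := by
      apply aux_step (a * t) D k c (c' - c)
        (2 * k * (Y c - Y c') + 2 * k * a * (if Y c = 0 then 1 else 0)) hat hkZ (by linarith) hc
      · have i1 : -a ≤ Y c - Y c' := by linarith
        have i2 : (0 : ℤ) ≤ 2 * k * a * (if Y c = 0 then 1 else 0) := by split_ifs <;> simp; positivity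
        have i3 : 2 * (k:ℤ) * (-a) ≤ 2 * k * (Y c - Y c') :=
          mul_le_mul_of_nonneg_left i1 (by positivity)
        have i4 : 2 * (k:ℤ) * a * 1 ≤ 2 * k * a * t :=
          mul_le_mul_of_nonneg_left (by linarith) (by positivity)
        linarith
      · have i1 : Y c - Y c' ≤ a := by linarith
        have i2 : 2 * k * a * (if Y c = 0 then 1 else 0) ≤ 2 * (k : ℤ) * a := by
          split_ifs <;> simp; positivity
        have i3 : 2 * (k:ℤ) * (Y c - Y c') ≤ 2 * k * a :=
          mul_le_mul_of_nonneg_left i1 (by positivity)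
        have i4 : 4 * (k:ℤ) * a * 1 ≤ 4 * k * a * t :=
          mul_le_mul_of_nonneg_left (by linarith) (by positivity)
        linarith
      · simp only [hN] at h
        linear_combination 2 * a * h + e1 - e2
    have : c' = c + k := by linarith
    rw [← this]; exact h
  have hdelta : ∀ c, W (c + k) = W c + k * N c ↔
      a * t * k + D + 2 * (Y (c + k) - Y c) = 2 * a * (if Y c = 0 then 1 else 0) := by
    intro c
    have e1 := haW c
    have e2 := haW (c + k)
    have ha2 : 2 * a ≠ 0 := by positivity
    constructor
    · intro h
      simp only [hN] at h
      apply mul_left_cancel₀ hkZ.ne'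
      linear_combination 2 * a * h + e1 - e2
    · intro h
      apply mul_left_cancel₀ ha2
      simp only [hN]
      linear_combination e2 - e1 + k * h
  have hBa : B + b < a * (B + b + 1) := by nlinarith
  have hd1 := (hdelta (a * (B + b + 1))).1 (hlarge _ (by linarith))
  have hd2 := (hdelta (a * (B + b + 1) - b)).1 (hlarge _ (by linarith))
  rw [hY0 (a * (B + b + 1)) (dvd_mul_right _ _), if_pos rfl] at hd1
  have hYb : Y (a * (B + b + 1) - b) = 1 :=
    huniq _ 1 (by norm_num) ha ⟨B + b + 1, by ring⟩
  rw [hYb, if_neg one_ne_zero] at hd2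
  have i1 := hY2 (a * (B + b + 1) + k)
  have i2 := hY1 (a * (B + b + 1) - b + k)
  have hDelta : a * t * k + D = 2 := by omega
  have hYk : Y (a * (B + b + 1) + k) = a - 1 := by omega
  have hkb : a ∣ (k : ℤ) - b := by
    have e := hXY (a * (B + b + 1) + k)
    rw [hYk] at e
    exact ⟨X (a * (B + b + 1) + k) - (B + b + 1) - b, by linear_combination -e⟩
  have hak : IsCoprime a (k : ℤ) := by
    obtain ⟨g, hg⟩ := hkb
    have : (k : ℤ) = b + a * g := by linarith
    rw [this]
    exact hab.add_mul_left_right g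
  have hall : ∀ c, W (c + k) = W c + k * N c := by
    intro c
    rw [hdelta]
    have y1 := hY1 c
    have y2 := hY2 c
    have hdv : a ∣ (c + k) + b * (Y c - 1) := by
      obtain ⟨g, hg⟩ := hkb
      exact ⟨X c + g, by linear_combination hg - hXY c⟩
    split_ifs with h0
    · have : Y (c + k) = a - 1 := by
        apply huniq _ _ (by omega) (by omega)
        rw [h0] at hdv
        obtain ⟨g, hg⟩ := hdv
        exact ⟨g + b, by linear_combination hg⟩
      rw [this, h0]; linarith
    · have : Y (c + k) = Y c - 1 := huniq _ _ (by omega) (by omega) hdv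
      rw [this]; linarith
  have hwdv : ∀ c : ℕ, ∃ w : ℤ, a * w = c + k * Y c := by
    intro c
    obtain ⟨g, hg⟩ := hkb
    exact ⟨X c + g * Y c, by linear_combination hXY c - Y c * hg⟩
  choose w hw using hwdv
  refine aux_final a t F k ht hk hak (fun c => Y c) w (fun c => W c) (fun c => hY1 c)
    (fun c => hY2 c) hw ?_ ?_
  · intro c
    have e := haW c
    apply mul_left_cancel₀ ha0.ne'
    linear_combination e - 2 * hw c + c * hDelta
  · intro v hv hvk
    obtain ⟨c, j, hc, hj, hjN, h⟩ := hsurj' v hv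
    have hwc := hnn' c hc
    have hj0 : j = 0 := by
      by_contra hne
      have : (k : ℤ) * 1 ≤ k * j := mul_le_mul_of_nonneg_left (by omega) hkZ.le
      linarith
    subst hj0
    have hck : c < k := by
      by_contra hcon
      push Not at hcon
      have e := hall (c - k)
      rw [sub_add_cancel] at e
      have p1 := hNpos (c - k) (by linarith)
      have p2 := hnn' (c - k) (by linarith)
      have : (k : ℤ) * 1 ≤ k * N (c - k) := mul_le_mul_of_nonneg_left (by omega) hkZ.le
      linarith
    refine ⟨c.toNat, by omega, ?_⟩
    simp only [Int.toNat_of_nonneg hc]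
    linarith

theorem k_dvd_l (n m : ℕ) (hn : 0 < n) (hm : 2 ≤ m) (hnm : m < n)
    (hco : Nat.Coprime n m) (hdvd : n ∣ (m - 1) ^ 2) (k : ℕ)
    (hex : ∃ p : ℝ → ℝ → ℝ, IsAscendingKStair (n : ℤ) (m : ℤ) k p ∧
      IsPackingPolyOn p (sectorLattice (n : ℤ) (m : ℤ))) :
    k ∣ Nat.gcd n (m - 1) := by
  obtain ⟨M, rfl⟩ : ∃ M, m = M + 1 := ⟨m - 1, by omega⟩
  simp only [Nat.add_sub_cancel] at *
  have hM : 0 < M := by omega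
  obtain ⟨l, hl⟩ : ∃ l, l = Nat.gcd n M := ⟨_, rfl⟩
  have hlpos : 0 < l := by rw [hl]; exact Nat.gcd_pos_of_pos_left _ hn
  obtain ⟨a, b, hcop, hna, hMb⟩ : ∃ a b, Nat.Coprime a b ∧ n = a * l ∧ M = b * l := by
    obtain ⟨a, b, h1, h2, h3⟩ := Nat.exists_coprime n M
    exact ⟨a, b, h1, by rw [hl]; exact h2, by rw [hl]; exact h3⟩
  have hgcdZ : (Int.gcd (n : ℤ) (((M + 1 : ℕ) : ℤ) - 1) : ℤ) = l := by
    rw [hl]; push_cast; simp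
  rw [← hl]
  clear hl
  have hal : a ∣ l := by
    have : a * l ∣ (b ^ 2 * l) * l := by
      rw [← hna]; convert hdvd using 1; rw [hMb]; ring
    have := Nat.dvd_of_mul_dvd_mul_right hlpos this
    exact (hcop.pow_right 2).dvd_of_dvd_mul_left this
  obtain ⟨t, rfl⟩ := hal
  have hb : 0 < b := by
    rcases Nat.eq_zero_or_pos b with h | h
    · subst h; simp at hMb; omega
    · exact h
  have hab : b < a := by
    by_contra h
    push Not at h
    have := Nat.mul_le_mul_right (a * t) h
    omega
  have ht : 0 < t := Nat.pos_of_mul_pos_left hlpos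
  obtain ⟨p, ⟨⟨⟨d, e, f, hp⟩, hint, -⟩, hasc⟩, hpk1, hpk2, hpk3⟩ := hex
  apply Dvd.dvd.mul_left
  have hnR : (n : ℝ) = a * (a * t) := by rw [hna]; push_cast; ring
  have hMR : (M : ℝ) = b * (a * t) := by rw [hMb]; push_cast; ring
  have haR : (a : ℝ) ≠ 0 := Nat.cast_ne_zero.2 (by omega)
  have htR : (t : ℝ) ≠ 0 := by positivity
  have hp' : ∀ x y : ℝ, 2 * p x y = t * (a * x - b * y) ^ 2 + (2 * d) * x + (2 * e) * y + 2 * f := by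
    intro x y
    rw [hp]; push_cast; rw [hnR, hMR]
    field_simp
    ring
  choose Q hQ using hint
  obtain ⟨F, hF⟩ : ∃ F : ℤ, (F : ℝ) = f := by
    refine ⟨Q 0 0, ?_⟩
    rw [← hQ, hp]; simp
  obtain ⟨D, hD⟩ : ∃ D : ℤ, (D : ℝ) = 2 * d := by
    refine ⟨2 * Q 1 0 - t * a ^ 2 - 2 * F, ?_⟩
    have h1 := hp' (1 : ℤ) (0 : ℤ)
    rw [hQ] at h1
    push_cast at h1 ⊢
    rw [h1, hF]; ring
  obtain ⟨E, hE⟩ : ∃ E : ℤ, (E : ℝ) = 2 * e := by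
    refine ⟨2 * Q 0 1 - t * b ^ 2 - 2 * F, ?_⟩
    have h1 := hp' (0 : ℤ) (1 : ℤ)
    rw [hQ] at h1
    push_cast at h1 ⊢
    rw [h1, hF]; ring
  have hsec : ∀ x y : ℤ, (x, y) ∈ sectorLattice (n : ℤ) ((M + 1 : ℕ) : ℤ) ↔
      0 ≤ y ∧ y ≤ a * t * (a * x - b * y) := by
    intro x y
    have hnZ : (n : ℤ) = a * (a * t) := by rw [hna]; push_cast; ring
    have hMZ : (M : ℤ) = b * (a * t) := by rw [hMb]; push_cast; ring
    simp only [sectorLattice, Set.mem_ofPred_eq]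
    push_cast
    rw [hnZ, hMZ]
    constructor
    · rintro ⟨-, h2, h3⟩
      exact ⟨h2, by linarith⟩
    · rintro ⟨h2, h3⟩
      have ha0 : (0 : ℤ) < a := by exact_mod_cast (by omega : 0 < a)
      have hat : (0 : ℤ) < a * t := by positivity
      have h4 : (0 : ℤ) ≤ a * x - b * y := nonneg_of_mul_nonneg_right (h2.trans h3) hat
      have h5 : (0 : ℤ) ≤ a * x := by
        have : (0 : ℤ) ≤ b * y := by positivity
        linarith
      exact ⟨nonneg_of_mul_nonneg_right h5 ha0, h2, by linarith⟩
  have hatZ : (1 : ℤ) ≤ a * t := by exact_mod_cast hlpos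
  have haZ : (2 : ℤ) ≤ a := by exact_mod_cast (by omega : 2 ≤ a)
  have hbZ : (1 : ℤ) ≤ b := by exact_mod_cast hb
  have hcopZ : IsCoprime (a : ℤ) (b : ℤ) := Nat.isCoprime_iff_coprime.2 hcop
  have hDE : D * b + E * a = 2 * k := by
    have hcs : ConsecutiveStairs (n : ℤ) ((M + 1 : ℕ) : ℤ) (1, 0) (1 + b, a) := by
      refine ⟨a, ⟨?_, ?_⟩, ⟨?_, ?_⟩, ?_, ?_⟩
      · rw [hsec]; exact ⟨le_rfl, by nlinarith⟩
      · rw [hgcdZ, hna]; push_cast; ring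
      · rw [hsec]; exact ⟨by linarith, by nlinarith⟩
      · rw [hgcdZ, hna, hMb]; push_cast; ring
      · intro h
        have := congrArg Prod.snd h
        simp at this
        omega
      · rintro ⟨x, y⟩ ⟨-, h2⟩ ⟨h3, h4⟩
        rw [hgcdZ, hna, hMb] at h2
        simp only at h2 h3 h4
        rw [min_eq_left (by linarith)] at h3
        rw [max_eq_right (by linarith)] at h4
        push_cast at h2
        have h5 : (b : ℤ) * y = a * (x - 1) := by
          apply mul_left_cancel₀ (by linarith : (a * t : ℤ) ≠ 0)
          linear_combination h2
        have h6 : (b : ℤ) ∣ x - 1 := hcopZ.symm.dvd_of_dvd_mul_left ⟨y, h5.symm⟩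
        have := Int.le_of_dvd (by linarith) h6
        linarith
    have h := hasc _ _ hcs (by simp only; nlinarith)
    have h1 := hp' ((1 + b : ℤ)) (a : ℤ)
    have h0 := hp' (1 : ℤ) (0 : ℤ)
    simp only at h
    have : (D : ℝ) * b + E * a = 2 * k := by
      rw [hD, hE]
      push_cast at h h0 h1
      linear_combination 2 * h - h1 + h0
    exact_mod_cast this
  have key : (k : ℤ) ∣ (t : ℤ) := by
    refine aux_core a b t D E F k (by linarith) (by exact_mod_cast ht) (by linarith) hcopZ hDE Q
      ?_ ?_ ?_ ?_
    · intro x y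
      have h1 := hp' (x : ℤ) (y : ℤ)
      rw [hQ, ← hD, ← hE, ← hF] at h1
      exact_mod_cast h1
    · intro x y h1 h2
      obtain ⟨j, hj⟩ := hpk1 (x, y) ((hsec x y).2 ⟨h1, h2⟩)
      simp only [hQ] at hj
      have : Q x y = j := by exact_mod_cast hj
      omega
    · intro x y x' y' h1 h2 h3 h4 h5
      have := hpk2 ((hsec x y).2 ⟨h1, h2⟩) ((hsec x' y').2 ⟨h3, h4⟩) (by simp only [hQ, h5])
      exact ⟨congrArg Prod.fst this, congrArg Prod.snd this⟩
    · intro v hv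
      obtain ⟨⟨x, y⟩, hP, h⟩ := hpk3 v.toNat
      obtain ⟨h1, h2⟩ := (hsec x y).1 hP
      refine ⟨x, y, h1, h2, ?_⟩
      simp only [hQ] at h
      have : Q x y = v.toNat := by exact_mod_cast h
      rw [this, Int.toNat_of_nonneg hv]
  exact_mod_cast key
end

section
/- Let m, n be coprime positive integers with m ≥ 2 and n/m > 1. There exists an ascending 1-stair packing polynomial on S(n/m) if and only if n divides (m−1)² and (m−1) divides n. -/
theorem osc_core (N A T : ℤ) (hA : 0 < A) (hAN : A < N) (hT : 0 < T) (hc : IsCoprime N A)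
    (p : ℝ → ℝ → ℝ) (α f : ℝ)
    (hp : ∀ x y : ℝ, p x y = T / 2 * (N * x - A * y) ^ 2 + α * (N * x - A * y) + y / N + f)
    (hint : IntValued p)
    (hpack : IsPackingPolyOn p (sectorLattice (N ^ 2 * T) (N * T * A + 1))) : A = 1 := by
  have hN : 0 < N := by linarith
  have hNr : (0 : ℝ) < N := by exact_mod_cast hN
  have hTr : (0 : ℝ) < T := by exact_mod_cast hT
  obtain ⟨hnat, hinj, hsurj⟩ := hpack
  obtain ⟨x0, w, hw0, hwN, hxw⟩ : ∃ x0 w : ℤ, 0 ≤ w ∧ w < N ∧ N * x0 - A * w = 1 := by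
    obtain ⟨a, b, hab⟩ := hc
    refine ⟨a - A * ((b + N * 0) / N) + A * (-((-b) / N) + (b / N)), (-b) % N,
      Int.emod_nonneg _ hN.ne', Int.emod_lt_of_pos _ hN, ?_⟩
    have := Int.mul_ediv_add_emod (-b) N
    have h2 : (-b) % N = -b - N * ((-b) / N) := by linarith
    rw [h2]
    simp only [mul_zero, add_zero]
    linear_combination hab
  have hx0 : 0 < x0 := by
    by_contra h
    push Not at h
    nlinarith [mul_nonneg hA.le hw0]
  obtain ⟨z1, hz1⟩ := hint x0 w
  obtain ⟨z0, hz0⟩ := hint 0 0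
  have hxwr : (N : ℝ) * x0 - A * w = 1 := by exact_mod_cast hxw
  obtain ⟨B, hBdef⟩ : ∃ B : ℤ, B = z1 - z0 := ⟨_, rfl⟩
  have hB : (B : ℝ) = T / 2 + α + w / N := by
    rw [hBdef]; push_cast
    rw [← hz1, ← hz0, hp, hp, hxwr]; push_cast; ring
  have hB1 : 1 ≤ B := by
    by_contra hlt
    have hB0 : B ≤ 0 := by omega
    obtain ⟨k, hk⟩ : ∃ k : ℤ, k = -B := ⟨_, rfl⟩
    have hk0 : 0 ≤ k := by omega
    obtain ⟨j, hj⟩ : ∃ j : ℤ, j = T * (N * k) + B := ⟨_, rfl⟩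
    have hj0 : 0 ≤ j := by
      have : 1 ≤ T * N := by nlinarith
      rw [hj, show B = -k by omega]; nlinarith
    have hj1 : j ≤ T * (N * k) := by omega
    have hkN : 0 ≤ N * k := by positivity
    have e1 : ((x0 + k, w) : ℤ × ℤ) ∈ sectorLattice (N ^ 2 * T) (N * T * A + 1) := by
      refine ⟨by simp; omega, by simpa using hw0, ?_⟩
      simp only
      have : 1 ≤ N * T := by nlinarith
      have h3 : (1:ℤ) ≤ 1 + N * k := by omega
      have h4 : N * T * 1 ≤ N * T * (1 + N * k) := by gcongr
      have h5 : N * 1 ≤ N * T := by gcongr; omega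
      have h6 : N ^ 2 * T * (x0 + k) - N * T * A * w = N * T * (1 + N * k) := by
        linear_combination (N * T) * hxw
      linarith
    have e2 : ((k + A * j, N * j) : ℤ × ℤ) ∈ sectorLattice (N ^ 2 * T) (N * T * A + 1) := by
      refine ⟨by simp only; positivity, by simp only; positivity, ?_⟩
      simp only
      have : N * j ≤ N * (T * (N * k)) := by gcongr
      linarith
    have := hinj e1 e2 (by
      simp only [hp]
      push_cast
      have h1 : (N : ℝ) * (x0 + k) - A * w = 1 + N * k := by linear_combination hxwr
      have h2 : (N : ℝ) * (k + A * j) - A * (N * j) = N * k := by ring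
      rw [h1, h2]
      have h3 : (N : ℝ) * j / N = j := by field_simp
      rw [h3, hj]; push_cast; rw [hB]; ring)
    simp only [Prod.mk.injEq] at this
    obtain ⟨q1, q2⟩ := this
    have : (1 : ℤ) = 0 := by linear_combination N * q1 - A * q2 - hxw
    omega
  have hα : -(T / 2 : ℝ) < α := by
    have h1 : (1 : ℝ) ≤ B := by exact_mod_cast hB1
    have h2 : (w : ℝ) / N < 1 := by
      rw [div_lt_one hNr]; exact_mod_cast hwN
    linarith
  have hgmono : ∀ a b : ℤ, 0 ≤ a → a ≤ b →
      (T : ℝ) / 2 * a ^ 2 + α * a ≤ T / 2 * b ^ 2 + α * b := by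
    intro a b ha hab
    rcases hab.eq_or_lt with rfl | hlt
    · rfl
    have h1 : (a : ℝ) + 1 ≤ b := by exact_mod_cast hlt
    have h0 : (0 : ℝ) ≤ a := by exact_mod_cast ha
    have h2 : 0 ≤ (T : ℝ) / 2 * (b + a) + α := by nlinarith
    nlinarith [mul_nonneg (sub_nonneg.2 (by linarith : (a : ℝ) ≤ b)) h2]
  by_cases hwl : w ≤ N - 2
  · exfalso
    obtain ⟨c1, hc1⟩ : ∃ c1 : ℤ, c1 = N - A := ⟨_, rfl⟩
    have hc1p : 0 < c1 := by omega
    have e1 : ((1, 1) : ℤ × ℤ) ∈ sectorLattice (N ^ 2 * T) (N * T * A + 1) := by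
      refine ⟨by simp, by simp, ?_⟩
      simp only
      have : N * T * (A + 1) ≤ N * T * N := by gcongr; omega
      nlinarith
    obtain ⟨v, hv⟩ := hnat _ e1
    obtain ⟨Q, ⟨hQ1, hQ2, hQ3⟩, hQ⟩ := hsurj (v + (T * c1).toNat)
    have hTc : 0 ≤ T * c1 := by positivity
    have hcast : (((T * c1).toNat : ℕ) : ℝ) = T * c1 := by
      have : (((T * c1).toNat : ℕ) : ℤ) = T * c1 := Int.toNat_of_nonneg hTc
      exact_mod_cast this
    rw [Nat.cast_add, hcast, ← hv] at hQ
    obtain ⟨x, y⟩ := Q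
    simp only at hQ1 hQ2 hQ3 hQ
    obtain ⟨c, hcdef⟩ : ∃ c : ℤ, c = N * x - A * y := ⟨_, rfl⟩
    have hcr : (c : ℝ) = N * x - A * y := by exact_mod_cast hcdef
    have hc1r : (c1 : ℝ) = N - A := by exact_mod_cast hc1
    rw [hp, hp, ← hcr] at hQ
    push_cast at hQ
    rw [mul_one, mul_one, ← hc1r] at hQ
    have hyc : y ≤ N * T * c := by rw [hcdef]; linarith
    have hc0 : 0 ≤ c := by
      by_contra h
      push Not at h
      have : N * T * c < 0 := mul_neg_of_pos_of_neg (by positivity) h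
      omega
    have hQ' : (y : ℝ) / N = T / 2 * c1 ^ 2 + α * c1 + 1 / N + T * c1
        - (T / 2 * c ^ 2 + α * c) := by linarith
    rcases le_or_gt c c1 with h | h
    · have h1 := hgmono c c1 hc0 h
      have h2 : (y : ℝ) / N ≤ T * c := by
        rw [div_le_iff₀ hNr]
        have : (y : ℝ) ≤ N * T * c := by exact_mod_cast hyc
        linarith
      have h3 : (T : ℝ) * c ≤ T * c1 := by
        have : (c : ℝ) ≤ c1 := by exact_mod_cast h
        gcongr
      have h4 : (0 : ℝ) < 1 / N := by positivity
      linarith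
    · have h1 := hgmono (c1 + 1) c (by omega) h
      push_cast at h1
      have h2 : (0 : ℝ) ≤ y / N := by
        have : (0 : ℝ) ≤ y := by exact_mod_cast hQ2
        positivity
      have h3 : (0 : ℝ) ≤ 1 / N + w / N - B := by nlinarith
      have h4 : (1 : ℝ) / N + w / N < 1 := by
        rw [← add_div, div_lt_one hNr]
        have : (w : ℝ) ≤ N - 2 := by exact_mod_cast hwl
        linarith
      have h1 : (1 : ℝ) ≤ B := by exact_mod_cast hB1
      linarith
  · have hw : w = N - 1 := by omega
    rw [hw] at hxw
    have hd : N ∣ A - 1 := ⟨A - x0, by linear_combination hxw⟩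
    have := Int.eq_zero_of_dvd_of_nonneg_of_lt (by omega) (by omega) hd
    omega

theorem osc_forward (n m : ℕ) (hn : 0 < n) (hm : 2 ≤ m) (hnm : m < n)
    (p : ℝ → ℝ → ℝ) (hasc : IsAscendingKStair (n : ℤ) (m : ℤ) 1 p)
    (hpack : IsPackingPolyOn p (sectorLattice (n : ℤ) (m : ℤ))) :
    n ∣ (m - 1) ^ 2 ∧ (m - 1) ∣ n := by
  obtain ⟨⟨⟨d, e, f, hp⟩, hint, -⟩, hstep⟩ := hasc
  obtain ⟨a, rfl⟩ : ∃ a, m = a + 1 := ⟨m - 1, by omega⟩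
  have ha : 0 < a := by omega
  simp only [Nat.add_sub_cancel]
  have hnr : (0 : ℝ) < n := by exact_mod_cast hn
  have hdvd : n ∣ a ^ 2 := by
    obtain ⟨z0, h0⟩ := hint 0 0
    obtain ⟨z1, h1⟩ := hint 0 1
    obtain ⟨z2, h2⟩ := hint 0 2
    rw [hp] at h0 h1 h2
    have : ((a : ℤ) ^ 2) = n * (z2 - 2 * z1 + z0) := by
      have : ((a : ℝ) ^ 2) = n * (z2 - 2 * z1 + z0) := by
        rw [← h0, ← h1, ← h2]; push_cast; field_simp; ring
      exact_mod_cast this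
    have h3 : (n : ℤ) ∣ (a : ℤ) ^ 2 := ⟨_, this⟩
    exact_mod_cast h3
  refine ⟨hdvd, ?_⟩
  obtain ⟨l, hl⟩ : ∃ l, l = Nat.gcd n a := ⟨_, rfl⟩
  have hlpos : 0 < l := hl ▸ Nat.gcd_pos_of_pos_left _ hn
  obtain ⟨N, A, hcop, hnN, haA⟩ : ∃ N A : ℕ, Nat.Coprime N A ∧ n = N * l ∧ a = A * l := by
    obtain ⟨N, A, h1, h2, h3⟩ := Nat.exists_coprime n a
    exact ⟨N, A, h1, by rw [hl]; exact h2, by rw [hl]; exact h3⟩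
  have hNl : N ∣ l := by
    have h1 : l * N ∣ l * (l * A ^ 2) := by
      have : l * (l * A ^ 2) = a ^ 2 := by rw [haA]; ring
      rw [this, mul_comm l N, ← hnN]; exact hdvd
    have h2 := Nat.dvd_of_mul_dvd_mul_left hlpos h1
    exact (Nat.Coprime.pow_right 2 hcop).dvd_of_dvd_mul_right h2
  obtain ⟨T, hT⟩ := hNl
  have hT0 : 0 < T := Nat.pos_of_ne_zero (by rintro rfl; simp at hT; omega)
  have hN0 : 0 < N := Nat.pos_of_ne_zero (by rintro rfl; simp at hnN; omega)
  have hA0 : 0 < A := Nat.pos_of_ne_zero (by rintro rfl; simp at haA; omega)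
  have hAN : A < N := by
    have : A * l < N * l := by rw [← hnN, ← haA]; omega
    exact lt_of_mul_lt_mul_right this (Nat.zero_le _)
  have hNz : (0 : ℤ) < N := by exact_mod_cast hN0
  have hAz : (0 : ℤ) < A := by exact_mod_cast hA0
  have hTz : (0 : ℤ) < T := by exact_mod_cast hT0
  have hlz : (l : ℤ) = N * T := by exact_mod_cast hT
  have hnz : (n : ℤ) = N ^ 2 * T := by rw [hnN]; push_cast; rw [hlz]; ring
  have haz : ((a + 1 : ℕ) : ℤ) = N * T * A + 1 := by rw [haA]; push_cast; rw [hlz]; ring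
  have hgcd : (Int.gcd (n : ℤ) (((a + 1 : ℕ) : ℤ) - 1) : ℤ) = N * T := by
    rw [← hlz, hl]
    have : (((a + 1 : ℕ) : ℤ) - 1) = (a : ℤ) := by push_cast; ring
    rw [this, Int.gcd_natCast_natCast]
  have hcons : ConsecutiveStairs (n : ℤ) ((a + 1 : ℕ) : ℤ) (1, 0) (1 + A, N) := by
    refine ⟨N, ⟨⟨by simp, by simp, by simp⟩, ?_⟩, ⟨⟨by simp; omega, by simp, ?_⟩, ?_⟩, ?_, ?_⟩
    · rw [hgcd, hnz]; ring
    · simp only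
      rw [hnz, haz]
      have : (N : ℤ) * 1 ≤ N * (N * T) := by
        have : (0 : ℤ) < N * T := by positivity
        apply mul_le_mul_of_nonneg_left _ hNz.le
        omega
      nlinarith
    · rw [hgcd, hnz, haz]; ring
    · intro h
      simp only [Prod.mk.injEq] at h
      omega
    · rintro ⟨x, y⟩ ⟨-, ht⟩ ⟨h1, h2⟩
      rw [hgcd, hnz, haz] at ht
      simp only at ht h1 h2
      rw [min_eq_left (by omega)] at h1
      rw [max_eq_right (by omega)] at h2
      have h3 : (A : ℤ) * y = N * (x - 1) := by
        have h4 : (N * T : ℤ) ≠ 0 := by positivity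
        apply mul_left_cancel₀ h4
        linear_combination ht
      have h5 : (A : ℤ) ∣ x - 1 := by
        have h6 : (A : ℤ) ∣ N * (x - 1) := ⟨y, h3.symm⟩
        exact (Nat.isCoprime_iff_coprime.2 hcop).symm.dvd_of_dvd_mul_left h6
      have := Int.eq_zero_of_dvd_of_nonneg_of_lt (by omega) (by omega) h5
      omega
  have hone := hstep _ _ hcons (by simp only; nlinarith)
  have hNr : (0 : ℝ) < N := by exact_mod_cast hN0
  have hTr : (0 : ℝ) < T := by exact_mod_cast hT0
  have hnR : (n : ℝ) = N ^ 2 * T := by exact_mod_cast hnz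
  have haR : (a : ℝ) = N * T * A := by
    have : (a : ℤ) = N * T * A := by push_cast at haz; linarith
    exact_mod_cast this
  have hp2 : ∀ x y : ℝ, p x y = T / 2 * (N * x - A * y) ^ 2 + d * x + e * y + f := by
    intro x y
    rw [hp]; push_cast; rw [hnR, haR]; field_simp; ring
  have hde : d * A + e * N = 1 := by
    rw [hp2, hp2] at hone
    push_cast at hone
    linear_combination hone
  have hA1 := osc_core N A T hAz (by exact_mod_cast hAN) hTz
    (Nat.isCoprime_iff_coprime.2 hcop) p (d / N) f (by
      intro x y
      rw [hp2]
      have he : e = (1 - d * A) / N := by field_simp; linarith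
      rw [he]; push_cast; field_simp; ring) hint (by rw [← hnz, ← haz]; exact hpack)
  have : A = 1 := by exact_mod_cast hA1
  subst this
  exact ⟨N, by rw [hnN, haA]; ring⟩

theorem osc_backward (N T : ℤ) (hN : 0 < N) (hT : 0 < T) :
    ∃ p : ℝ → ℝ → ℝ, IsAscendingKStair (N ^ 2 * T) (N * T + 1) 1 p ∧
        IsPackingPolyOn p (sectorLattice (N ^ 2 * T) (N * T + 1)) := by
  have hNr : (0 : ℝ) < N := by exact_mod_cast hN
  have hTr : (0 : ℝ) < T := by exact_mod_cast hT
  have hNT : 0 < N * T := by positivity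
  obtain ⟨p, hp⟩ : ∃ p : ℝ → ℝ → ℝ,
      p = fun x y : ℝ => (T : ℝ) / 2 * ((N * x - y) * (N * x - y - 1)) + x := ⟨_, rfl⟩
  have hgcd : (Int.gcd (N ^ 2 * T) (N * T + 1 - 1) : ℤ) = N * T := by
    rw [add_sub_cancel_right, show N ^ 2 * T = (N * T) * N by ring, Int.gcd_mul_right_left]
    exact Int.natAbs_of_nonneg hNT.le
  -- membership
  have hmem : ∀ x y : ℤ, (x, y) ∈ sectorLattice (N ^ 2 * T) (N * T + 1) ↔
      0 ≤ y ∧ y ≤ N * T * (N * x - y) := by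
    intro x y
    simp only [sectorLattice, Set.mem_ofPred_eq]
    constructor
    · rintro ⟨-, h2, h3⟩
      exact ⟨h2, by linarith⟩
    · rintro ⟨h2, h3⟩
      refine ⟨?_, h2, by linarith⟩
      have h4 : 0 ≤ N * x - y := by
        by_contra h
        push Not at h
        have := mul_neg_of_pos_of_neg hNT h
        omega
      have : 0 ≤ N * x := by omega
      exact nonneg_of_mul_nonneg_right this hN
  have hst : ∀ (c : ℕ) (x y : ℤ), (x, y) ∈ staircase (N ^ 2 * T) (N * T + 1) c ↔
      y = N * x - c ∧ 0 ≤ y ∧ y ≤ N * T * c := by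
    intro c x y
    simp only [staircase, Set.mem_ofPred_eq]
    rw [hgcd, hmem]
    constructor
    · rintro ⟨⟨h1, h2⟩, h3⟩
      have : y = N * x - c := by
        apply mul_left_cancel₀ hNT.ne'
        linear_combination h3
      refine ⟨this, h1, ?_⟩
      rw [this, sub_sub_cancel] at h2
      rw [this]
      exact h2
    · rintro ⟨h1, h2, h3⟩
      refine ⟨⟨h2, ?_⟩, ?_⟩
      · rw [h1, sub_sub_cancel]; rw [h1] at h3; exact h3
      · rw [h1]; ring
  have hcons : ∀ r s, ConsecutiveStairs (N ^ 2 * T) (N * T + 1) r s →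
      ∃ c : ℕ, r.2 = N * r.1 - c ∧ s.2 = N * s.1 - c ∧ 0 ≤ r.2 ∧ 0 ≤ s.2 ∧ 0 ≤ r.1 ∧ 0 ≤ s.1 ∧
      (r.1 = s.1 + 1 ∨ s.1 = r.1 + 1) := by
    rintro ⟨x, y⟩ ⟨x', y'⟩ ⟨c, hr, hs, hne, hb⟩
    have hx := hr.1.1
    have hx' := hs.1.1
    obtain ⟨r1, r2, r3⟩ := (hst _ _ _).1 hr
    obtain ⟨s1, s2, s3⟩ := (hst _ _ _).1 hs
    refine ⟨c, r1, s1, r2, s2, hx, hx', ?_⟩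
    simp only at hx hx' hb ⊢
    have hxx : x ≠ x' := by
      rintro rfl
      exact hne (by rw [r1, s1])
    by_contra hcon
    push Not at hcon
    rcases lt_or_gt_of_ne hxx with h | h
    · refine hb (x + 1, N * (x + 1) - c) ((hst _ _ _).2 ⟨rfl, ?_, ?_⟩) ?_
      · nlinarith
      · have : N * (x + 1) ≤ N * x' := by gcongr; omega
        omega
      · simp only [min_eq_left h.le, max_eq_right h.le]; omega
    · refine hb (x' + 1, N * (x' + 1) - c) ((hst _ _ _).2 ⟨rfl, ?_, ?_⟩) ?_
      · nlinarith
      · have : N * (x' + 1) ≤ N * x := by gcongr; omega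
        omega
      · simp only [min_eq_right h.le, max_eq_left h.le]; omega
  have hval : ∀ (x y c : ℤ), y = N * x - c → p x y = T / 2 * (c * (c - 1)) + x := by
    rintro x y c rfl
    rw [hp]; push_cast; simp only [sub_sub_cancel]
  have heven : ∀ c : ℤ, ∃ h : ℤ, c * (c - 1) = 2 * h := by
    intro c
    obtain ⟨h, hh⟩ := Int.even_mul_pred_self c
    exact ⟨h, by rw [hh]; ring⟩
  choose H hH using heven
  have hval2 : ∀ x y : ℤ, p x y = ((T * H (N * x - y) + x : ℤ) : ℝ) := by
    intro x y
    rw [hval x y (N * x - y) (by ring)]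
    have : (((N * x - y : ℤ) : ℝ) * (((N * x - y : ℤ) : ℝ) - 1)) = 2 * H (N * x - y) := by
      exact_mod_cast hH (N * x - y)
    rw [this]; push_cast; ring
  have hHs : ∀ c, H (c + 1) = H c + c := by
    intro c
    have h1 := hH c
    have h2 := hH (c + 1)
    have : 2 * H (c + 1) = 2 * (H c + c) := by rw [← h2, mul_add, ← h1]; ring
    omega
  have hH0 : H 0 = 0 := by have := hH 0; omega
  have hHnn : ∀ c : ℕ, 0 ≤ H c := by
    intro c
    induction c with
    | zero => simp [hH0]
    | succ k ih => push_cast; rw [hHs]; omega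
  have hcnn : ∀ x y : ℤ, (x, y) ∈ sectorLattice (N ^ 2 * T) (N * T + 1) →
      ∃ c : ℕ, N * x - y = c := by
    intro x y h
    obtain ⟨h1, h2⟩ := (hmem x y).1 h
    have h4 : 0 ≤ N * x - y := by
      by_contra h
      push Not at h
      have := mul_neg_of_pos_of_neg hNT h
      omega
    exact ⟨(N * x - y).toNat, (Int.toNat_of_nonneg h4).symm⟩
  refine ⟨p, ⟨⟨⟨1 - T * N / 2, T / 2, 0, ?_⟩, ?_, ?_⟩, ?_⟩, ?_, ?_, ?_⟩
  · intro x y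
    rw [hp]; push_cast; field_simp; ring
  · intro x y
    exact ⟨_, hval2 x y⟩
  · intro r s hrs
    obtain ⟨c, h1, h2, -, -, -, -, h3⟩ := hcons r s hrs
    rw [hval _ _ _ h1, hval _ _ _ h2]
    rcases h3 with h | h <;> rw [h] <;> push_cast
    · left; ring
    · right; ring
  · intro r s hrs hlt
    obtain ⟨c, h1, h2, h4, h5, h6, h7, h3⟩ := hcons r s hrs
    rw [hval _ _ _ h1, hval _ _ _ h2]
    rcases h3 with h | h
    · exfalso
      have : s.2 ≤ r.2 := by rw [h1, h2, h]; nlinarith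
      nlinarith
    · rw [h]; push_cast; ring
  · rintro ⟨x, y⟩ hP
    obtain ⟨c, hc⟩ := hcnn x y hP
    have hx : 0 ≤ x := hP.1
    have h0 : 0 ≤ T * H (N * x - y) + x := by
      rw [hc]
      have := hHnn c
      positivity
    refine ⟨(T * H (N * x - y) + x).toNat, ?_⟩
    simp only
    rw [hval2, ← Int.cast_natCast, Int.toNat_of_nonneg h0]
  · -- injectivity
    have key : ∀ (c : ℕ) (e : ℕ) (x y x' y' : ℤ), 
        (x, y) ∈ sectorLattice (N ^ 2 * T) (N * T + 1) →
        (x', y') ∈ sectorLattice (N ^ 2 * T) (N * T + 1) →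
        N * x - y = c → N * x' - y' = c + e + 1 →
        T * H (N * x - y) + x < T * H (N * x' - y') + x' := by
      intro c e x y x' y' h1 h2 hc hc'
      obtain ⟨a1, a2⟩ := (hmem x y).1 h1
      obtain ⟨b1, b2⟩ := (hmem x' y').1 h2
      rw [hc, hc']
      rw [hc] at a2
      have hmono : ∀ e : ℕ, H (c + 1) ≤ H (c + e + 1) := by
        intro e
        induction e with
        | zero => simp
        | succ k ih =>
          have := hHs (c + k + 1)
          push_cast
          rw [show (c : ℤ) + (k + 1) + 1 = c + k + 1 + 1 by ring, this]
          omega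
      have h3 : T * H (c + 1) ≤ T * H (c + e + 1) := by
        have := hmono e
        gcongr
      rw [hHs, mul_add] at h3
      have h4 : x < T * c + x' := by
        apply lt_of_mul_lt_mul_left (a := N) _ hN.le
        nlinarith
      linarith
    rintro ⟨x, y⟩ hP ⟨x', y'⟩ hP' heq
    simp only at heq
    rw [hval2, hval2] at heq
    have heq' : T * H (N * x - y) + x = T * H (N * x' - y') + x' := by exact_mod_cast heq
    obtain ⟨c, hc⟩ := hcnn x y hP
    obtain ⟨c', hc'⟩ := hcnn x' y' hP'
    rcases lt_trichotomy c c' with h | h | h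
    · have := key c (c' - c - 1) x y x' y' hP hP' hc (by omega)
      omega
    · subst h
      rw [hc, hc'] at heq'
      have hx : x = x' := by omega
      subst hx
      have : y = y' := by omega
      rw [this]
    · have := key c' (c - c' - 1) x' y' x y hP' hP hc' (by omega)
      omega
  · -- surjectivity
    have key : ∀ j : ℕ, ∃ x y : ℤ, (x, y) ∈ sectorLattice (N ^ 2 * T) (N * T + 1) ∧
        T * H (N * x - y) + x = j := by
      intro j
      induction j with
      | zero => exact ⟨0, 0, (hmem _ _).2 (by simp), by simp [hH0]⟩
      | succ j ih =>
        obtain ⟨x, y, hxy, hj⟩ := ih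
        obtain ⟨h1, h2⟩ := (hmem x y).1 hxy
        obtain ⟨c, hc⟩ := hcnn x y hxy
        rw [hc] at h2 hj
        by_cases hlast : y + N ≤ N * T * c
        · have e : N * (x + 1) - (y + N) = c := by linarith
          refine ⟨x + 1, y + N, (hmem _ _).2 ⟨by omega, ?_⟩, ?_⟩
          · rw [e]; exact hlast
          · rw [e]; push_cast; omega
        · -- next staircase
          push Not at hlast
          have e : N * (x + 1 - T * c) - (N * (x + 1 - T * c) - (c + 1)) = c + 1 := by ring
          refine ⟨x + 1 - T * c, N * (x + 1 - T * c) - (c + 1), (hmem _ _).2 ⟨?_, ?_⟩, ?_⟩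
          · nlinarith
          · rw [e]
            have : 0 ≤ (T:ℤ) * (c + 1) - 1 := by nlinarith [Int.natCast_nonneg c]
            nlinarith
          · rw [e, hHs]; push_cast; linarith
    intro j
    obtain ⟨x, y, h1, h2⟩ := key j
    refine ⟨(x, y), h1, ?_⟩
    simp only
    rw [hval2, h2, Int.cast_natCast]

theorem one_stair_classification (n m : ℕ) (hn : 0 < n) (hm : 2 ≤ m) (hnm : m < n)
    (hco : Nat.Coprime n m) :
    (∃ p : ℝ → ℝ → ℝ, IsAscendingKStair (n : ℤ) (m : ℤ) 1 p ∧
        IsPackingPolyOn p (sectorLattice (n : ℤ) (m : ℤ))) ↔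
    (n ∣ (m - 1) ^ 2 ∧ (m - 1) ∣ n) := by
  constructor
  · rintro ⟨p, h1, h2⟩
    exact osc_forward n m hn hm hnm p h1 h2
  · rintro ⟨h1, h2⟩
    obtain ⟨a, rfl⟩ : ∃ a, m = a + 1 := ⟨m - 1, by omega⟩
    simp only [Nat.add_sub_cancel] at h1 h2
    have ha : 0 < a := by omega
    obtain ⟨N, rfl⟩ := h2
    have h3 : N ∣ a := by
      rw [pow_two] at h1
      exact Nat.dvd_of_mul_dvd_mul_left ha h1
    obtain ⟨T, rfl⟩ := h3
    have hN0 : 0 < N := Nat.pos_of_ne_zero (by rintro rfl; simp at ha)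
    have hT0 : 0 < T := Nat.pos_of_ne_zero (by rintro rfl; simp at ha)
    have h := osc_backward N T (by exact_mod_cast hN0) (by exact_mod_cast hT0)
    have e1 : ((N * T * N : ℕ) : ℤ) = N ^ 2 * T := by push_cast; ring
    have e2 : ((N * T + 1 : ℕ) : ℤ) = N * T + 1 := by push_cast; ring
    rw [e1, e2]
    exact h
end

section
/- Let m, n be coprime positive integers with m ≥ 2 and n/m > 1. There exists an ascending 2-stair packing polynomial on S(n/m) if and only if m ≡ 9 (mod 16) and n = (m−1)²/16. -/
set_option maxHeartbeats 2000000 in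
lemma combin (k q : ℤ) (hk : 2 ≤ k) (hq : 0 < q) (a : ℤ → ℤ)
    (a0 : ∀ c, 0 ≤ a c) (ak : ∀ c, a c < k) (az : a 0 = 0) (aper : ∀ c, a (c + k) = a c)
    (N : ℤ → ℤ) (hN1 : ∀ c, k ∣ c → N c = q * c + 1) (hN0 : ∀ c, ¬ k ∣ c → N c = q * c)
    (D f : ℝ) (F : ℤ → ℝ)
    (hF : ∀ c : ℤ, F c = q / 2 * (c : ℝ) ^ 2 + D * c + 2 * (a c : ℝ) / k + f)
    (h1 : ∀ c t : ℤ, 0 ≤ t → t < N c → ∃ v : ℕ, F c + 2 * t = v)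
    (h2 : ∀ c t c' t' : ℤ, 0 ≤ t → t < N c → 0 ≤ t' → t' < N c' →
      F c + 2 * t = F c' + 2 * t' → c = c' ∧ t = t')
    (h3 : ∀ v : ℕ, ∃ c t : ℤ, 0 ≤ t ∧ t < N c ∧ F c + 2 * t = v) :
    a 2 = k - 1 ∧ (k : ℝ) * (q + D) = 1 := by
  have hkR : (2 : ℝ) ≤ k := by exact_mod_cast hk
  have hqR : (1 : ℝ) ≤ q := by exact_mod_cast hq
  have hNb : ∀ c, q * c ≤ N c ∧ N c ≤ q * c + 1 := by
    intro c
    by_cases h : k ∣ c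
    · rw [hN1 c h]; omega
    · rw [hN0 c h]; omega
  have step : ∀ c : ℤ, 1 ≤ c → ∃ c' : ℤ, 0 ≤ c' ∧ F c' = F c + 2 * N c := by
    intro c hc
    have hNc : 1 ≤ N c := by nlinarith [(hNb c).1]
    obtain ⟨v, hv⟩ := h1 c (N c - 1) (by omega) (by omega)
    obtain ⟨c', t, ht0, htN, ht⟩ := h3 (v + 2)
    have hc' : 0 ≤ c' := by
      by_contra hneg
      push Not at hneg
      nlinarith [(hNb c').2]
    push_cast at hv ht
    rcases eq_or_lt_of_le ht0 with h | h
    · refine ⟨c', hc', ?_⟩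
      rw [← h] at ht
      push_cast at ht
      linarith
    · exfalso
      obtain ⟨e1, e2⟩ := h2 c' (t - 1) c (N c - 1) (by omega) (by omega) (by omega) (by omega)
        (by push_cast; linarith)
      subst e1
      omega
  obtain ⟨C, hC⟩ := exists_nat_gt (4 * |D| + 20)
  have hab : ∀ c, 0 ≤ 2 * (a c : ℝ) / k ∧ 2 * (a c : ℝ) / k < 2 := by
    intro c
    have h0 : (0 : ℝ) ≤ a c := by exact_mod_cast a0 c
    have h1 : (a c : ℝ) < k := by exact_mod_cast ak c
    constructor
    · positivity
    · rw [div_lt_iff₀ (by linarith)]; linarith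
  have step2 : ∀ c : ℤ, (C : ℤ) ≤ c → F (c + 2) = F c + 2 * N c := by
    intro c hc
    have hcR : 4 * |D| + 20 < (c : ℝ) := lt_of_lt_of_le hC (by exact_mod_cast hc)
    have hD1 := le_abs_self D
    have hD2 := neg_abs_le D
    have hD0 := abs_nonneg D
    have hc1 : 1 ≤ c := by
      have : (1 : ℝ) ≤ c := by linarith
      exact_mod_cast this
    obtain ⟨c', hc'0, hc'⟩ := step c hc1
    obtain ⟨h, rfl⟩ : ∃ h, c' = c + h := ⟨c' - c, by ring⟩
    have hn1 : (q : ℝ) * c ≤ N c := by exact_mod_cast (hNb c).1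
    have hn2 : (N c : ℝ) ≤ q * c + 1 := by exact_mod_cast (hNb c).2
    have key := hc'
    rw [hF, hF] at key
    push_cast at key
    have b1 := hab c
    have b2 := hab (c + h)
    have eq1 : (h : ℝ) * (q * c + q * h / 2 + D) = 2 * N c + 2 * (a c : ℝ) / k
        - 2 * (a (c + h) : ℝ) / k := by linear_combination key
    have lo : 2 * (q : ℝ) * c - 2 < (h : ℝ) * (q * c + q * h / 2 + D) := by linarith
    have hi : (h : ℝ) * (q * c + q * h / 2 + D) < 2 * (q : ℝ) * c + 4 := by linarith
    have hqc : (c : ℝ) ≤ q * c := by nlinarith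
    have hqc2 : 4 * |D| + 20 * q ≤ (q : ℝ) * c := by nlinarith
    have hh : h = 2 := by
      rcases lt_trichotomy h 2 with hl | hl | hl
      · exfalso
        rcases lt_or_ge h 0 with hn | hn
        · have hhR : (h : ℝ) ≤ -1 := by exact_mod_cast (by omega : h ≤ -1)
          have : (0 : ℝ) ≤ c + h := by exact_mod_cast hc'0
          have : (0 : ℝ) ≤ q * (c + h) := by positivity
          have : 0 ≤ (q : ℝ) * c + q * h / 2 + D := by nlinarith
          nlinarith
        · have : h = 0 ∨ h = 1 := by omega
          rcases this with rfl | rfl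
          · push_cast at lo; nlinarith
          · push_cast at lo; nlinarith
      · exact hl
      · exfalso
        have hhR : (3 : ℝ) ≤ h := by exact_mod_cast (by omega : 3 ≤ h)
        have : (q : ℝ) * c + D ≤ q * c + q * h / 2 + D := by nlinarith
        nlinarith
    rw [hh] at hc'
    exact hc'
  have hkne : (k : ℝ) ≠ 0 := by linarith
  have rec1 : ∀ c : ℤ, (C : ℤ) ≤ c → k ∣ c →
      ((a (c + 2) : ℝ) - a c) = k - k * (q + D) := by
    intro c hc hd
    have := step2 c hc
    rw [hF, hF, hN1 c hd] at this
    push_cast at this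
    field_simp at this
    linear_combination this / 4
  have rec0 : ∀ c : ℤ, (C : ℤ) ≤ c → ¬ k ∣ c →
      ((a (c + 2) : ℝ) - a c) = - (k * (q + D)) := by
    intro c hc hd
    have := step2 c hc
    rw [hF, hF, hN0 c hd] at this
    push_cast at this
    field_simp at this
    linear_combination this / 4
  have aperm : ∀ (s : ℕ) (c : ℤ), a (c + s * k) = a c := by
    intro s
    induction s with
    | zero => intro c; simp
    | succ s ih =>
      intro c
      rw [← ih c, ← aper (c + s * k)]
      congr 1
      push_cast; ring
  have hCk : (C : ℤ) ≤ C * k := by nlinarith [Int.natCast_nonneg C]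
  have H : ∀ i : ℕ, (i : ℤ) + 1 ≤ k → (a (C * k + (i + 1)) : ℝ) + a (C * k + (i + 2))
      = a (C * k) + a (C * k + 1) + k - (i + 1) * (k * (q + D)) := by
    intro i
    induction i with
    | zero =>
      intro _
      have := rec1 (C * k) hCk (Dvd.intro_left _ rfl)
      simp only [Nat.cast_zero, zero_add]
      linarith
    | succ i ih =>
      intro hi
      push_cast at hi
      have h := ih (by omega)
      have := rec0 (C * k + (i + 1)) (by omega) (by
        intro hd
        have h' := (Int.dvd_add_right (Dvd.intro_left (C : ℤ) rfl)).1 hd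
        have := Int.le_of_dvd (by omega) h'
        omega)
      push_cast
      rw [show (C * k + (i + 1) + 2 : ℤ) = C * k + (i + 1 + 2) by ring] at this
      rw [show (C * k + (i + 2) : ℤ) = C * k + (i + 1 + 1) by ring] at h
      linarith
  have hK : (k : ℝ) * (q + D) = 1 := by
    have h := H (k - 1).toNat (by omega)
    have e : (((k - 1).toNat : ℕ) : ℤ) = k - 1 := by omega
    have eR : (((k - 1).toNat : ℕ) : ℝ) = k - 1 := by exact_mod_cast e
    rw [e, eR, show (C * k + (k - 1 + 1) : ℤ) = C * k + k by ring,
      show (C * k + (k - 1 + 2) : ℤ) = (C * k + 1) + k by ring, aper, aper] at h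
    have : (k : ℝ) * (1 - k * (q + D)) = 0 := by linear_combination -h
    rcases mul_eq_zero.1 this with h | h
    · exact absurd h hkne
    · linarith
  refine ⟨?_, hK⟩
  have h := rec1 (C * k) hCk (Dvd.intro_left _ rfl)
  rw [add_comm, aperm C 2, show ((C : ℤ) * k) = 0 + C * k by ring, aperm C 0, az, hK] at h
  have : (a 2 : ℝ) = ((k - 1 : ℤ) : ℝ) := by push_cast; push_cast at h; linarith
  exact_mod_cast this

set_option maxHeartbeats 2000000 in
lemma core (k j q : ℤ) (hjk : j < k) (hj : 0 < j) (hq : 0 < q) (hco : IsCoprime j k)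
    (d e f : ℝ) (hde : d * j + e * k = 2) (P : ℤ → ℤ → ℝ)
    (hP : ∀ x y : ℤ, P x y = q / 2 * ((k : ℝ) * x - j * y) ^ 2 + d * x + e * y + f)
    (R : ℤ → ℤ → Prop)
    (hR : ∀ x y : ℤ, R x y ↔ 0 ≤ x ∧ 0 ≤ y ∧ y ≤ q * k * (k * x - j * y))
    (h1 : ∀ x y, R x y → ∃ v : ℕ, P x y = v)
    (h2 : ∀ x y x' y', R x y → R x' y' → P x y = P x' y' → x = x' ∧ y = y')
    (h3 : ∀ v : ℕ, ∃ x y, R x y ∧ P x y = v) : j = 2 ∧ q = 4 := by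
  have hk : 2 ≤ k := by omega
  have hkR : (2 : ℝ) ≤ k := by exact_mod_cast hk
  have hkne : (k : ℝ) ≠ 0 := by linarith
  have hR' : ∀ x y : ℤ, R x y ↔ 0 ≤ y ∧ y ≤ q * k * (k * x - j * y) := by
    intro x y
    rw [hR]
    constructor
    · rintro ⟨_, h⟩; exact h
    · rintro ⟨h, h'⟩
      refine ⟨?_, h, h'⟩
      have hc : 0 ≤ k * x - j * y := by
        have : 0 < q * k := by positivity
        by_contra hn
        push Not at hn
        nlinarith
      have : 0 ≤ j * y := by positivity
      by_contra hn
      push Not at hn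
      nlinarith
  obtain ⟨u, w, huw⟩ := hco
  -- `u * j + w * k = 1`
  set a : ℤ → ℤ := fun c => (-(c * u)) % k with ha
  have a0 : ∀ c, 0 ≤ a c := fun c => Int.emod_nonneg _ (by omega)
  have ak : ∀ c, a c < k := fun c => Int.emod_lt_of_pos _ (by omega)
  have adv : ∀ c, ∃ b, k * b = c + j * a c := by
    intro c
    have := Int.emod_add_mul_ediv (-(c * u)) k
    refine ⟨c * w - j * ((-(c * u)) / k), ?_⟩
    have h' : a c = -(c * u) - k * ((-(c * u)) / k) := by simp only [ha]; linarith
    rw [h']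
    linear_combination c * huw
  choose b hb using adv
  have az : a 0 = 0 := by simp [ha]
  have aper : ∀ c, a (c + k) = a c := by
    intro c
    simp only [ha]
    rw [show -((c + k) * u) = -(c * u) + k * (-u) by ring, Int.add_mul_emod_self_left]
  have auniq : ∀ c y : ℤ, k ∣ c + j * y → ∃ t, y = a c + k * t := by
    intro c y hd
    have : k ∣ j * (y - a c) := by
      have h2 : k ∣ c + j * a c := ⟨b c, (hb c).symm⟩
      have := Int.dvd_sub hd h2
      convert this using 1; ring
    have hco' : IsCoprime k j := ⟨w, u, by linarith⟩
    obtain ⟨t, ht⟩ := hco'.dvd_of_dvd_mul_left this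
    exact ⟨t, by linarith⟩
  have azero : ∀ c, k ∣ c ↔ a c = 0 := by
    intro c
    constructor
    · intro hd
      simp only [ha]
      exact Int.emod_eq_zero_of_dvd ((hd.mul_right u).neg_right)
    · intro h
      have := hb c
      rw [h] at this
      exact ⟨b c, by linarith⟩
  classical
  set N : ℤ → ℤ := fun c => q * c + if k ∣ c then 1 else 0 with hN
  have hreg : ∀ c t : ℤ, R (b c + j * t) (a c + k * t) ↔ 0 ≤ t ∧ t < N c := by
    intro c t
    have hc : k * (b c + j * t) - j * (a c + k * t) = c := by linear_combination hb c
    rw [hR', hc]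
    have e1 : 0 ≤ a c + k * t ↔ 0 ≤ t := by
      have := a0 c
      have := ak c
      constructor
      · intro h
        by_contra hn
        push Not at hn
        nlinarith
      · intro h
        have : 0 ≤ k * t := by positivity
        linarith
    have e2 : a c + k * t ≤ q * k * c ↔ t < N c := by
      have h0 := a0 c
      have h1 := ak c
      by_cases hd : k ∣ c
      · have hz := (azero c).1 hd
        simp only [hN, hd, if_true, hz]
        constructor
        · intro h
          by_contra hn
          push Not at hn
          nlinarith
        · intro h
          have : t ≤ q * c := by omega
          nlinarith
      · have hz : a c ≠ 0 := fun h => hd ((azero c).2 h)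
        have hz' : 1 ≤ a c := by omega
        simp only [hN, hd, if_false, add_zero]
        constructor
        · intro h
          by_contra hn
          push Not at hn
          nlinarith
        · intro h
          have : t + 1 ≤ q * c := by omega
          nlinarith
    rw [e1, e2]
  have hV : ∀ c t : ℤ, P (b c + j * t) (a c + k * t) =
      (q / 2 * (c : ℝ) ^ 2 + d / k * c + 2 * (a c : ℝ) / k + f) + 2 * t := by
    intro c t
    have hc : (k : ℝ) * (b c) = c + j * a c := by exact_mod_cast hb c
    rw [hP]
    push_cast
    have : (k : ℝ) * (b c + j * t) - j * (a c + k * t) = c := by linear_combination hc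
    rw [this]
    have h' : d / k * c + 2 * (a c : ℝ) / k = d * b c + e * a c := by
      field_simp
      linear_combination (-d) * hc - (a c : ℝ) * hde
    linear_combination t * hde - h'
  have hcov : ∀ x y : ℤ, ∃ c t, x = b c + j * t ∧ y = a c + k * t := by
    intro x y
    obtain ⟨t, ht⟩ := auniq (k * x - j * y) y ⟨x, by ring⟩
    refine ⟨k * x - j * y, t, ?_, ht⟩
    have := hb (k * x - j * y)
    have : k * x = k * (b (k * x - j * y) + j * t) := by
      rw [mul_add, this]
      linear_combination j * ht
    exact mul_left_cancel₀ (by omega) this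
  obtain ⟨r1, r2⟩ := combin k q hk hq a a0 ak az aper N
    (by intro c h; simp [hN, h]) (by intro c h; simp [hN, h]) (d / k) f
    (fun c => q / 2 * (c : ℝ) ^ 2 + d / k * c + 2 * (a c : ℝ) / k + f) (fun c => rfl)
    (by
      intro c t ht htN
      have := h1 _ _ ((hreg c t).2 ⟨ht, htN⟩)
      rwa [hV] at this)
    (by
      intro c t c' t' ht htN ht' htN' hE
      obtain ⟨ex, ey⟩ := h2 _ _ _ _ ((hreg c t).2 ⟨ht, htN⟩) ((hreg c' t').2 ⟨ht', htN'⟩)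
        (by rw [hV, hV]; exact hE)
      have ec : c = c' := by
        have h1 := hb c
        have h2 := hb c'
        linear_combination k * ex - j * ey - h1 + h2
      subst ec
      refine ⟨rfl, ?_⟩
      have : k * t = k * t' := by linarith
      exact mul_left_cancel₀ (by omega) this)
    (by
      intro v
      obtain ⟨x, y, hxy, hv⟩ := h3 v
      obtain ⟨c, t, rfl, rfl⟩ := hcov x y
      obtain ⟨g1, g2⟩ := (hreg c t).1 hxy
      exact ⟨c, t, g1, g2, by rw [← hV]; exact hv⟩)
  have hj2 : j = 2 := by
    have h := hb 2
    rw [r1] at h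
    obtain ⟨z, hz⟩ : k ∣ 2 - j := ⟨b 2 - j, by linear_combination -h⟩
    have : z = 0 := by
      have : z < 1 := by by_contra hn; push Not at hn; nlinarith
      have : -1 < z := by by_contra hn; push Not at hn; nlinarith
      omega
    rw [this] at hz
    omega
  refine ⟨hj2, ?_⟩
  subst hj2
  have hd : d = 1 - k * q := by field_simp at r2; linarith
  have he : e = 2 * q := by
    push_cast at hde
    have : (k : ℝ) * (e - 2 * q) = 0 := by rw [hd] at hde; linear_combination hde
    rcases mul_eq_zero.1 this with h | h
    · exact absurd h hkne
    · linarith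
  have hP' : ∀ x y : ℤ, P x y =
      q / 2 * (((k * x - 2 * y : ℤ) : ℝ) ^ 2 - 2 * ((k * x - 2 * y : ℤ) : ℝ)) + x + f := by
    intro x y
    rw [hP, hd, he]
    push_cast
    ring
  obtain ⟨f', hf'⟩ : ∃ f' : ℕ, f = f' := by
    obtain ⟨v, hv⟩ := h1 0 0 ((hR' 0 0).2 (by simp))
    rw [hP'] at hv
    exact ⟨v, by simpa using hv⟩
  obtain ⟨s, hs⟩ : ∃ s, k = 2 * s + 1 := by
    rcases Int.even_or_odd' k with ⟨s, hs | hs⟩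
    · exfalso
      rw [hs] at huw
      have : 2 * (u + w * s) = 1 := by linarith
      omega
    · exact ⟨s, hs⟩
  obtain ⟨v1, hv1⟩ := h1 1 s ((hR' 1 s).2 ⟨by omega, by
    rw [show k * 1 - 2 * s = 1 by omega]; nlinarith⟩)
  rw [hP', show k * 1 - 2 * s = 1 by omega, hf'] at hv1
  push_cast at hv1
  have hv1' : (q : ℤ) = 2 * (1 + f' - v1) := by
    have : (q : ℝ) = 2 * (1 + f' - v1) := by linarith
    exact_mod_cast this
  obtain ⟨q', hq'⟩ : ∃ q' : ℤ, q = 2 * q' := ⟨_, hv1'⟩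
  have hval : ∀ v : ℕ, ∃ x y : ℤ, R x y ∧
      q' * ((k * x - 2 * y) ^ 2 - 2 * (k * x - 2 * y)) + x + f' = v := by
    intro v
    obtain ⟨x, y, hxy, hv⟩ := h3 v
    refine ⟨x, y, hxy, ?_⟩
    rw [hP', hq', hf'] at hv
    have : ((q' * ((k * x - 2 * y) ^ 2 - 2 * (k * x - 2 * y)) + x + f' : ℤ) : ℝ) = (v : ℤ) := by
      push_cast
      push_cast at hv
      linarith
    exact_mod_cast this
  have hq'even : Even q' := by
    by_contra hne
    have ho := Int.not_even_iff_odd.1 hne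
    obtain ⟨x, y, -, hv⟩ := hval (f' + 1)
    push_cast at hv
    have hv : q' * ((k * x - 2 * y) ^ 2 - 2 * (k * x - 2 * y)) + x = 1 := by linarith
    obtain ⟨z, rfl⟩ := ho
    have h3 : (k * x - 2 * y) = x + 2 * (s * x - y) := by rw [hs]; ring
    rw [h3] at hv
    obtain ⟨g, hg⟩ := Int.even_mul_succ_self x
    generalize s * x - y = i at hv
    have : x * x = 2 * g - x := by linarith
    have : 2 * (g + z * ((x + 2 * i) ^ 2 - 2 * (x + 2 * i)) + 2 * x * i + 2 * i ^ 2 - x - 2 * i) = 1 := by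
      linear_combination hv - this
    omega
  obtain ⟨r, hr⟩ := hq'even
  have hr0 : 0 < r := by omega
  by_contra hne
  have hr2 : 2 ≤ r := by omega
  have hf3 : 3 ≤ f' := by omega
  obtain ⟨x, y, hxy, hv⟩ := hval (f' % 2)
  have hx0 := ((hR x y).1 hxy).1
  have hv2 : q' * ((k * x - 2 * y) ^ 2 - 2 * (k * x - 2 * y)) < 0 := by omega
  have hc1 : k * x - 2 * y = 1 := by
    have hq'0 : 0 < q' := by omega
    have : (k * x - 2 * y) ^ 2 - 2 * (k * x - 2 * y) < 0 := by
      by_contra hn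
      push Not at hn
      have := mul_nonneg hq'0.le hn
      omega
    generalize k * x - 2 * y = c at this
    have : 0 < c := by nlinarith
    have : c < 2 := by nlinarith
    omega
  rw [hc1] at hv
  have hxo : x % 2 = 1 := by
    have : x + 2 * (s * x - y) = 1 := by rw [hs] at hc1; linarith
    omega
  omega

set_option maxHeartbeats 2000000 in
lemma forward (n m : ℕ) (hn : 0 < n) (hm : 2 ≤ m) (hnm : m < n)
    (h : ∃ p : ℝ → ℝ → ℝ, IsAscendingKStair (n : ℤ) (m : ℤ) 2 p ∧
        IsPackingPolyOn p (sectorLattice (n : ℤ) (m : ℤ))) :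
    (m ≡ 9 [MOD 16] ∧ 16 * n = (m - 1) ^ 2) := by
  obtain ⟨p, ⟨⟨⟨d, e, f, hp⟩, hint, -⟩, hasc⟩, pk1, pk2, pk3⟩ := h
  have hnR : (0 : ℝ) < n := by exact_mod_cast hn
  push_cast at hp
  have hdiv : (n : ℤ) ∣ ((m : ℤ) - 1) ^ 2 := by
    obtain ⟨z0, h0⟩ := hint 0 0
    obtain ⟨z1, h1⟩ := hint 0 1
    obtain ⟨z2, h2⟩ := hint 0 2
    rw [hp] at h0 h1 h2
    refine ⟨z2 - 2 * z1 + z0, ?_⟩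
    have : ((m : ℝ) - 1) ^ 2 = n * (z2 - 2 * z1 + z0) := by
      rw [← h0, ← h1, ← h2]
      push_cast
      field_simp
      ring
    exact_mod_cast this
  obtain ⟨g, hg⟩ : ∃ g : ℤ, g = (Int.gcd (n : ℤ) ((m : ℤ) - 1) : ℤ) := ⟨_, rfl⟩
  have hg0 : 0 < g := by
    rw [hg]
    exact_mod_cast Int.gcd_pos_of_ne_zero_left _ (by omega)
  obtain ⟨k, hk⟩ : g ∣ (n : ℤ) := hg ▸ Int.gcd_dvd_left ..
  obtain ⟨j, hj⟩ : g ∣ (m : ℤ) - 1 := hg ▸ Int.gcd_dvd_right ..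
  have hco : IsCoprime j k := by
    rw [isCoprime_comm, Int.isCoprime_iff_gcd_eq_one]
    rw [hk, hj, Int.gcd_mul_left] at hg
    push_cast at hg
    rw [abs_of_pos hg0] at hg
    have : g * (Int.gcd k j : ℤ) = g * 1 := by linarith
    exact_mod_cast mul_left_cancel₀ hg0.ne' this
  have hk0 : 0 < k := by
    have : 0 < g * k := by omega
    exact (pos_iff_pos_of_mul_pos this).1 hg0
  have hj0 : 0 < j := by
    have : 0 < g * j := by omega
    exact (pos_iff_pos_of_mul_pos this).1 hg0
  have hjk : j < k := by
    have : g * j < g * k := by omega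
    exact lt_of_mul_lt_mul_left this hg0.le
  obtain ⟨q, hq⟩ : k ∣ g := by
    rw [hk, hj] at hdiv
    have : g * k ∣ g * (j ^ 2 * g) := by convert hdiv using 1; ring
    have := Int.dvd_of_mul_dvd_mul_left hg0.ne' this
    exact (hco.symm.pow_right).dvd_of_dvd_mul_left this
  have hq0 : 0 < q := by
    have : 0 < k * q := by omega
    exact (pos_iff_pos_of_mul_pos this).1 hk0
  have hn' : (n : ℤ) = k ^ 2 * q := by rw [hk, hq]; ring
  have hm' : (m : ℤ) = k * q * j + 1 := by rw [← hq, ← hj]; ring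
  have hnR' : (n : ℝ) = k ^ 2 * q := by exact_mod_cast hn'
  have hmR' : (m : ℝ) = k * q * j + 1 := by exact_mod_cast hm'
  have hkR : (0 : ℝ) < k := by exact_mod_cast hk0
  have hqR : (0 : ℝ) < q := by exact_mod_cast hq0
  have hP : ∀ x y : ℝ, p x y = q / 2 * ((k : ℝ) * x - j * y) ^ 2 + d * x + e * y + f := by
    intro x y
    rw [hp, hnR', hmR']
    congr 3
    field_simp
    ring
  have hreg : ∀ x y : ℤ, (x, y) ∈ sectorLattice (n : ℤ) (m : ℤ) ↔
      0 ≤ x ∧ 0 ≤ y ∧ y ≤ q * k * (k * x - j * y) := by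
    intro x y
    simp only [sectorLattice, Set.mem_ofPred_eq]
    rw [hn', hm']
    refine and_congr_right fun _ => and_congr_right fun _ => ?_
    constructor <;> intro h <;> linarith
  have hde : d * j + e * k = 2 := by
    have hs : ∀ x y : ℤ, (x, y) ∈ staircase (n : ℤ) (m : ℤ) k.toNat ↔
        (x, y) ∈ sectorLattice (n : ℤ) (m : ℤ) ∧ j * y = k * (x - 1) := by
      intro x y
      simp only [staircase, Set.mem_ofPred_eq]
      refine and_congr_right fun _ => ?_
      rw [← hg, hj, hk, Int.toNat_of_nonneg hk0.le]
      constructor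
      · intro h
        apply mul_left_cancel₀ hg0.ne'
        linarith
      · intro h
        linear_combination g * h
    have hqk : 0 < q * k := by positivity
    have := hasc (1, 0) (1 + j, k) ⟨k.toNat, ?_, ?_, ?_, ?_⟩ ?_
    · simp only [hP] at this
      push_cast at this
      linear_combination this
    · rw [hs, hreg]
      refine ⟨⟨by omega, le_refl _, ?_⟩, by ring⟩
      have : 0 < q * k * k := by positivity
      linarith
    · rw [hs, hreg]
      refine ⟨⟨by omega, by omega, ?_⟩, by ring⟩
      rw [show k * (1 + j) - j * k = k by ring]
      nlinarith
    · simp; omega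
    · rintro ⟨x, y⟩ ht ⟨h1, h2⟩
      rw [hs] at ht
      simp only at h1 h2
      rw [min_eq_left (by omega)] at h1
      rw [max_eq_right (by omega)] at h2
      have : j ∣ x - 1 := hco.dvd_of_dvd_mul_left ⟨y, ht.2.symm⟩
      have := Int.le_of_dvd (by omega) this
      omega
    · simp only
      nlinarith
  obtain ⟨r1, r2⟩ := core k j q hjk hj0 hq0 hco d e f hde (fun x y => p x y)
    (fun x y => hP x y) (fun x y => (x, y) ∈ sectorLattice (n : ℤ) (m : ℤ)) hreg
    (fun x y hxy => pk1 (x, y) hxy)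
    (by
      intro x y x' y' h h' hE
      have := pk2 h h' hE
      simpa using this)
    (by
      intro v
      obtain ⟨⟨x, y⟩, h, h'⟩ := pk3 v
      exact ⟨x, y, h, h'⟩)
  subst r1 r2
  obtain ⟨s, hs⟩ : ∃ s, k = 2 * s + 1 := by
    rcases Int.even_or_odd' k with ⟨s, hs | hs⟩
    · exfalso
      obtain ⟨u, w, huw⟩ := hco
      rw [hs] at huw
      have : 2 * (u + w * s) = 1 := by linarith
      omega
    · exact ⟨s, hs⟩
  constructor
  · unfold Nat.ModEq
    omega
  · zify [show 1 ≤ m by omega]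
    rw [hm', hn']
    ring

set_option maxHeartbeats 2000000 in
lemma backward (n m : ℕ) (hn : 0 < n) (hm : 2 ≤ m)
    (h : m ≡ 9 [MOD 16] ∧ 16 * n = (m - 1) ^ 2) :
    ∃ p : ℝ → ℝ → ℝ, IsAscendingKStair (n : ℤ) (m : ℤ) 2 p ∧
        IsPackingPolyOn p (sectorLattice (n : ℤ) (m : ℤ)) := by
  obtain ⟨h1, h2⟩ := h
  obtain ⟨s, hs⟩ : ∃ s : ℕ, m = 16 * s + 9 := ⟨m / 16, by unfold Nat.ModEq at h1; omega⟩
  obtain ⟨k, hk⟩ : ∃ k : ℤ, k = 2 * s + 1 := ⟨_, rfl⟩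
  have hk0 : 0 < k := by omega
  have hm' : (m : ℤ) = 8 * k + 1 := by omega
  have hn' : (n : ℤ) = 4 * k ^ 2 := by
    zify [show 1 ≤ m by omega] at h2
    rw [hm'] at h2
    linarith
  have hmR : (m : ℝ) = 8 * k + 1 := by exact_mod_cast hm'
  have hnR : (n : ℝ) = 4 * k ^ 2 := by exact_mod_cast hn'
  have hkR : (0 : ℝ) < k := by exact_mod_cast hk0
  have hg : (Int.gcd (n : ℤ) ((m : ℤ) - 1) : ℤ) = 4 * k := by
    rw [hn', hm', show 4 * k ^ 2 = (4 * k) * k by ring, show 8 * k + 1 - 1 = (4 * k) * 2 by ring,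
      Int.gcd_mul_left]
    have : Int.gcd k 2 = 1 := by
      rw [← Int.isCoprime_iff_gcd_eq_one]
      exact ⟨1, -s, by rw [hk]; ring⟩
    rw [this]
    omega
  have hreg : ∀ x y : ℤ, (x, y) ∈ sectorLattice (n : ℤ) (m : ℤ) ↔
      0 ≤ x ∧ 0 ≤ y ∧ y ≤ 4 * k * (k * x - 2 * y) := by
    intro x y
    simp only [sectorLattice, Set.mem_ofPred_eq]
    rw [hn', hm']
    refine and_congr_right fun _ => and_congr_right fun _ => ?_
    constructor <;> intro h <;> linarith
  have hst : ∀ (c : ℕ) (x y : ℤ), (x, y) ∈ staircase (n : ℤ) (m : ℤ) c ↔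
      (x, y) ∈ sectorLattice (n : ℤ) (m : ℤ) ∧ k * x - 2 * y = c := by
    intro c x y
    simp only [staircase, Set.mem_ofPred_eq]
    refine and_congr_right fun _ => ?_
    rw [hg, hm', hn']
    constructor
    · intro h
      have : (4 * k) * (k * x - 2 * y) = (4 * k) * c := by linarith
      exact mul_left_cancel₀ (by omega) this
    · intro h
      linear_combination (-4 * k) * h
  set p : ℝ → ℝ → ℝ := fun x y => 2 * (k * x - 2 * y) ^ 2 - 4 * (k * x - 2 * y) + x + 1 with hp
  have hpZ : ∀ x y : ℤ, p x y =
      ((2 * (k * x - 2 * y) ^ 2 - 4 * (k * x - 2 * y) + x + 1 : ℤ) : ℝ) := by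
    intro x y
    simp only [hp]
    push_cast
    ring
  -- consecutive stairs, ordered by abscissa
  have hcons : ∀ r s : ℤ × ℤ, ConsecutiveStairs (n : ℤ) (m : ℤ) r s → r.1 ≤ s.1 →
      r.2 ≤ s.2 ∧ s.1 = r.1 + 2 ∧ p s.1 s.2 - p r.1 r.2 = 2 := by
    rintro ⟨x, y⟩ ⟨x', y'⟩ ⟨c, h1, h2, h3, h4⟩ hle
    simp only at hle h4 ⊢
    rw [hst, hreg] at h1 h2
    obtain ⟨⟨a1, a2, a3⟩, a4⟩ := h1
    obtain ⟨⟨b1, b2, b3⟩, b4⟩ := h2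
    have hne : x ≠ x' := by
      rintro rfl
      apply h3
      have : y = y' := by linarith
      rw [this]
    have hlt : x < x' := lt_of_le_of_ne hle hne
    rw [min_eq_left hle, max_eq_right hle] at h4
    obtain ⟨i, hi⟩ : ∃ i, x' = x + 2 * i := by
      refine ⟨y' - y - s * (x' - x), ?_⟩
      rw [hk] at a4 b4
      linarith
    have hi0 : 0 < i := by omega
    have hy : y' = y + k * i := by
      rw [hi] at b4
      linarith
    have hi1 : i = 1 := by
      by_contra hne
      have hi2 : 2 ≤ i := by omega
      apply h4 (x + 2, y + k)
      · rw [hst, hreg]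
        refine ⟨⟨by omega, by omega, ?_⟩, by linarith⟩
        rw [b4] at b3
        rw [show k * (x + 2) - 2 * (y + k) = c by linarith]
        nlinarith
      · simp only
        omega
    subst hi1
    refine ⟨by linarith, by omega, ?_⟩
    rw [hpZ, hpZ, a4, b4, hi]
    push_cast
    ring
  refine ⟨p, ⟨⟨⟨1 - 4 * k, 8, 1, ?_⟩, ?_, ?_⟩, ?_⟩, ?_, ?_, ?_⟩
  · intro x y
    simp only [hp]
    push_cast
    rw [hnR, hmR]
    field_simp
    ring
  · intro a b
    exact ⟨_, hpZ a b⟩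
  · intro r s h
    have hsym : ConsecutiveStairs (n : ℤ) (m : ℤ) s r := by
      obtain ⟨c, h1, h2, h3, h4⟩ := h
      refine ⟨c, h2, h1, h3.symm, ?_⟩
      rw [min_comm, max_comm]
      exact h4
    rcases le_total r.1 s.1 with hle | hle
    · right
      have := (hcons r s h hle).2.2
      push_cast
      linarith
    · left
      have := (hcons s r hsym hle).2.2
      push_cast
      linarith
  · intro r s h hlt
    have hsym : ConsecutiveStairs (n : ℤ) (m : ℤ) s r := by
      obtain ⟨c, h1, h2, h3, h4⟩ := h
      refine ⟨c, h2, h1, h3.symm, ?_⟩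
      rw [min_comm, max_comm]
      exact h4
    rcases le_total r.1 s.1 with hle | hle
    · have := (hcons r s h hle).2.2
      push_cast
      linarith
    · exfalso
      obtain ⟨h1, h2, -⟩ := hcons s r hsym hle
      obtain ⟨c, -, ⟨⟨g1, g2, -⟩, -⟩, -⟩ := h
      nlinarith
  · rintro ⟨x, y⟩ hxy
    rw [hreg] at hxy
    obtain ⟨a1, a2, a3⟩ := hxy
    have : 0 ≤ 2 * (k * x - 2 * y) ^ 2 - 4 * (k * x - 2 * y) + x + 1 := by
      rcases eq_or_lt_of_le a1 with h | h
      · rw [← h] at a3 ⊢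
        have : y = 0 := by
          by_contra hne
          have : 1 ≤ y := by omega
          nlinarith
        rw [this]
        simp
      · nlinarith [sq_nonneg (k * x - 2 * y - 1)]
    obtain ⟨v, hv⟩ := Int.eq_ofNat_of_zero_le this
    refine ⟨v, ?_⟩
    simp only
    rw [hpZ, hv]
    simp
  · -- injectivity
    have key : ∀ x y x' y' : ℤ, (x, y) ∈ sectorLattice (n : ℤ) (m : ℤ) →
        (x', y') ∈ sectorLattice (n : ℤ) (m : ℤ) →
        2 * (k * x - 2 * y) ^ 2 - 4 * (k * x - 2 * y) + x + 1 =
        2 * (k * x' - 2 * y') ^ 2 - 4 * (k * x' - 2 * y') + x' + 1 →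
        ¬ (k * x - 2 * y < k * x' - 2 * y') := by
      intro x y x' y' h h' hE hlt
      rw [hreg] at h h'
      obtain ⟨a1, a2, a3⟩ := h
      obtain ⟨b1, b2, b3⟩ := h'
      obtain ⟨c, hc⟩ : ∃ c, c = k * x - 2 * y := ⟨_, rfl⟩
      obtain ⟨c', hc'⟩ : ∃ c, c = k * x' - 2 * y' := ⟨_, rfl⟩
      rw [← hc, ← hc'] at hE hlt
      rw [← hc] at a3
      have hc0 : 0 ≤ c := by
        by_contra hn
        push Not at hn
        nlinarith
      have par : c' - c = 2 * (s * (x' - x) - y' + y + (c ^ 2 - c'^2) + 2 * (c' - c)) + (x' - x) - 2 * (c ^ 2 - c'^2) - 4 * (c' - c) := by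
        rw [hc, hc', hk]; ring
      have hxx : x' - x = 2 * (c ^ 2 - c'^2 + 2 * (c' - c)) := by linarith
      rw [hxx] at par
      have hge : c + 2 ≤ c' := by
        generalize s * (x' - x) = w at par
        generalize c ^ 2 - c' ^ 2 = w' at par
        omega
      have e1 : k * x ≤ c + 8 * k * c := by linarith
      have e2 : c' ≤ k * x' := by linarith
      have hxx2 : x' - x ≤ - 8 * c := by
        obtain ⟨δ, hδ⟩ : ∃ δ, c' = c + 2 + δ := ⟨c' - c - 2, by ring⟩
        have hδ0 : 0 ≤ δ := by omega
        have hδc := mul_nonneg hδ0 hc0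
        have hδδ := sq_nonneg δ
        rw [hxx, hδ]
        linarith
      have := mul_le_mul_of_nonneg_left hxx2 hk0.le
      linarith
    rintro ⟨x, y⟩ h ⟨x', y'⟩ h' hE
    simp only at hE
    rw [hpZ, hpZ] at hE
    have hE' := Int.cast_injective hE
    have k1 := key _ _ _ _ h h' hE'
    have k2 := key _ _ _ _ h' h hE'.symm
    have hcc : k * x - 2 * y = k * x' - 2 * y' := by omega
    rw [hcc] at hE'
    have hx : x = x' := by linarith
    subst hx
    have hy : y = y' := by linarith
    rw [hy]
  · -- surjectivity
    intro v
    -- candidates `c = 2 i + ε`, `ε = (v + 1) % 2`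
    obtain ⟨ε, hε⟩ : ∃ ε : ℤ, ε = ((v : ℤ) + 1) % 2 := ⟨_, rfl⟩
    have hε01 : ε = 0 ∧ (1 : ℤ) ≤ v ∨ ε = 1 := by omega
    have hstart : k * (2 * ε ^ 2 - 4 * ε + 1) + ε ≤ k * v := by
      rcases hε01 with ⟨h, h'⟩ | h
      · rw [h]; nlinarith
      · rw [h]; nlinarith [mul_nonneg hk0.le (Int.natCast_nonneg v)]
    have hε0 : 0 ≤ ε := by omega
    have hex : ∃ i : ℕ, k * v < k * (2 * (2 * i + ε) ^ 2 - 4 * (2 * i + ε) + 1) + (2 * i + ε) := by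
      refine ⟨v + 2, ?_⟩
      push_cast
      have : (v : ℤ) ≤ 2 * (2 * (v + 2) + ε) ^ 2 - 4 * (2 * (v + 2) + ε) + 1 := by
        nlinarith [Int.natCast_nonneg v]
      have := mul_le_mul_of_nonneg_left this hk0.le
      linarith [Int.natCast_nonneg v]
    classical
    have hi := Nat.find_spec hex
    have hmin := fun i => Nat.find_min hex (m := i)
    generalize Nat.find hex = i at hi hmin
    rcases i with _ | i
    · exfalso
      push_cast at hi
      simp only [mul_zero, zero_add] at hi
      linarith
    · have hi' := hmin i (by omega)
      push Not at hi'
      push_cast at hi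
      obtain ⟨c, hc⟩ : ∃ c : ℤ, c = 2 * i + ε := ⟨_, rfl⟩
      rw [← hc] at hi'
      rw [show 2 * ((i : ℤ) + 1) + ε = c + 2 by linarith] at hi
      obtain ⟨x, hx⟩ : ∃ x : ℤ, x = v - (2 * c ^ 2 - 4 * c + 1) := ⟨_, rfl⟩
      have hv : (v : ℤ) = x + (2 * c ^ 2 - 4 * c + 1) := by linarith
      rw [hv] at hi hi'
      have lo : c ≤ k * x := by linarith
      have hi2 : k * x < 8 * k * c + c + 2 := by linarith
      have hc0 : 0 ≤ c := by omega
      obtain ⟨z, hz⟩ : ∃ z, x = c + 2 * z := by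
        have : (v : ℤ) = ε + 1 + 2 * (((v : ℤ) - ε - 1) / 2) := by omega
        refine ⟨((v : ℤ) - ε - 1) / 2 - i - c ^ 2 + 2 * c, ?_⟩
        rw [hx]
        linarith
      obtain ⟨y, hy⟩ : ∃ y, k * x = c + 2 * y := by
        refine ⟨s * x + z, ?_⟩
        rw [hk]
        linarith
      refine ⟨(x, y), ?_, ?_⟩
      · rw [hreg]
        rw [show k * x - 2 * y = c by linarith]
        refine ⟨?_, by linarith, ?_⟩
        · by_contra hn
          push Not at hn
          nlinarith
        · have : 4 * k * c = 4 * (k * c) := by ring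
          have : 8 * k * c = 8 * (k * c) := by ring
          generalize k * c = w at *
          omega
      · simp only
        rw [hpZ, show k * x - 2 * y = c by linarith]
        have : 2 * c ^ 2 - 4 * c + x + 1 = v := by linarith
        rw [this]
        simp

theorem two_stair_classification (n m : ℕ) (hn : 0 < n) (hm : 2 ≤ m) (hnm : m < n)
    (hco : Nat.Coprime n m) :
    (∃ p : ℝ → ℝ → ℝ, IsAscendingKStair (n : ℤ) (m : ℤ) 2 p ∧
        IsPackingPolyOn p (sectorLattice (n : ℤ) (m : ℤ))) ↔
    (m ≡ 9 [MOD 16] ∧ 16 * n = (m - 1) ^ 2) :=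
  ⟨forward n m hn hm hnm, backward n m hn hm⟩
end

section
/- Let m, n be coprime positive integers with m ≥ 2 and n/m > 1. There exists an ascending 3-stair packing polynomial on S(n/m) if and only if either ((m ≡ 10 (mod 27) or m ≡ 19 (mod 27)) and n = (m−1)²/27), or n/m = 12/7. -/
/-- Asymptotic localisation of the successor staircase. -/
theorem ts_asym (t g d c c' B : ℤ) (ht : 1 ≤ t) (hg : 1 ≤ g) (hc' : 0 ≤ c')
    (hc : 4 * |d| + 12 * g + 5 ≤ c) (hB1 : -(12 * g) ≤ B) (hB2 : B ≤ 12 * g)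
    (h : t * g * (c' ^ 2 - c ^ 2) + d * (c' - c) + B = 6 * t * g * c) : c' = c + 3 := by
  obtain ⟨k, rfl⟩ : ∃ k, c' = c + k := ⟨c' - c, by ring⟩
  have hu : 1 ≤ t * g := by nlinarith
  rw [show 6 * t * g * c = 6 * (t * g) * c by ring] at h
  generalize t * g = u at *
  have hd1 := le_abs_self d
  have hd2 := neg_abs_le d
  have hd0 := abs_nonneg d
  generalize |d| = a at *
  have h' : u * k ^ 2 + (2 * u * c + d) * (k - 3) + 3 * d + B = 0 := by
    linarith [h, (by ring : u * ((c + k) ^ 2 - c ^ 2) + d * (c + k - c) + B - 6 * u * c = u * k ^ 2 + (2 * u * c + d) * (k - 3) + 3 * d + B)]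
  have huc : c ≤ u * c := by nlinarith
  rcases lt_trichotomy k 3 with hk | hk | hk
  · exfalso
    have h1 : k ^ 2 ≤ c * (3 - k) := by
      rcases le_or_gt k 0 with h0 | h0
      · nlinarith
      · have : k = 1 ∨ k = 2 := by omega
        rcases this with rfl | rfl <;> nlinarith
    have h2 : u * k ^ 2 ≤ u * (c * (3 - k)) := by
      apply mul_le_mul_of_nonneg_left h1; omega
    have h3 : (u * c + d) * 1 ≤ (u * c + d) * (3 - k) := by
      apply mul_le_mul_of_nonneg_left <;> omega
    nlinarith
  · rw [hk]
  · exfalso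
    have h3 : (2 * u * c + d) * 1 ≤ (2 * u * c + d) * (k - 3) := by
      apply mul_le_mul_of_nonneg_left <;> nlinarith
    have h4 : 0 ≤ u * k ^ 2 := by positivity
    nlinarith

/-- The integer core of the forward direction. -/
theorem ts_forward (g h t d e f : ℤ) (P : ℤ → ℤ → ℤ) (hg : 2 ≤ g) (h1 : 1 ≤ h)
    (ht : 1 ≤ t) (hco : IsCoprime g h)
    (hP : ∀ x y, 2 * P x y = t * (g * x - h * y) ^ 2 + d * x + e * y + 2 * f)
    (hde : d * h + e * g = 6)
    (hnn : ∀ x y, 0 ≤ y → y ≤ t * g * (g * x - h * y) → 0 ≤ P x y)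
    (hinj : ∀ x y x' y', 0 ≤ y → y ≤ t * g * (g * x - h * y) →
      0 ≤ y' → y' ≤ t * g * (g * x' - h * y') → P x y = P x' y' → x = x' ∧ y = y')
    (hsurj : ∀ j, 0 ≤ j → ∃ x y, 0 ≤ y ∧ y ≤ t * g * (g * x - h * y) ∧ P x y = j) :
    t = 3 ∧ g ∣ 3 - h := by
  obtain ⟨a, b, hab⟩ := hco
  -- `a * g + b * h = 1`
  have hg0 : 0 < g := by omega
  have htg : 0 < t * g := by positivity
  obtain ⟨Y, hY⟩ : ∃ Y : ℤ → ℤ, ∀ c, Y c = (-b * c) % g := ⟨_, fun _ => rfl⟩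
  have hY0 : ∀ c, 0 ≤ Y c := fun c => by rw [hY]; exact Int.emod_nonneg _ (by omega)
  have hYg : ∀ c, Y c < g := fun c => by rw [hY]; exact Int.emod_lt_of_pos _ hg0
  have hX : ∀ c, ∃ x, g * x = c + h * Y c := by
    intro c
    have := Int.emod_add_mul_ediv (-b * c) g
    rw [← hY] at this
    refine ⟨a * c - h * ((-b * c) / g), ?_⟩
    linear_combination (-c) * hab - h * this + 2 * c * hab - c * hab + c * hab
  choose X hX using hX
  have hYz : ∀ c, g ∣ c + h * Y c := fun c => ⟨X c, (hX c).symm⟩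
  have hYuniq : ∀ c y, 0 ≤ y → y < g → g ∣ c + h * y → y = Y c := by
    intro c y hy0 hyg hd
    have h2 : g ∣ h * (y - Y c) := by
      have := dvd_sub hd (hYz c)
      rwa [show c + h * y - (c + h * Y c) = h * (y - Y c) by ring] at this
    have h3 : g ∣ y - Y c := IsCoprime.dvd_of_dvd_mul_left ⟨a, b, hab⟩ h2
    have h4 := Int.eq_zero_of_abs_lt_dvd h3 (by rw [abs_lt]; constructor <;> linarith [hY0 c, hYg c])
    omega
  obtain ⟨F, hF⟩ : ∃ F : ℤ → ℤ, ∀ c, F c = P (X c) (Y c) := ⟨_, fun _ => rfl⟩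
  have hgF : ∀ c, 2 * g * F c = t * g * c ^ 2 + d * c + 6 * Y c + 2 * g * f := by
    intro c
    have e1 := hP (X c) (Y c)
    have e2 := hX c
    have e3 : g * X c - h * Y c = c := by linarith
    rw [e3] at e1
    rw [hF]
    linear_combination g * e1 + d * e2 + Y c * hde
  obtain ⟨N, hN⟩ : ∃ N : ℤ → ℤ, ∀ c, N c = t * c + if Y c = 0 then 1 else 0 := ⟨_, fun _ => rfl⟩
  have hPt : ∀ c i, P (X c + h * i) (Y c + g * i) = F c + 3 * i := by
    intro c i
    have e1 := hP (X c) (Y c)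
    have e2 := hP (X c + h * i) (Y c + g * i)
    rw [hF]
    have : 2 * P (X c + h * i) (Y c + g * i) = 2 * (P (X c) (Y c) + 3 * i) := by
      linear_combination e2 - e1 + i * hde
    omega
  have hcc : ∀ c i, g * (X c + h * i) - h * (Y c + g * i) = c := by
    intro c i; linear_combination hX c
  have hmem : ∀ c i, 0 ≤ i → i < N c →
      0 ≤ Y c + g * i ∧ Y c + g * i ≤ t * g * (g * (X c + h * i) - h * (Y c + g * i)) := by
    intro c i hi hiN
    rw [hcc]
    have := hY0 c
    have := hYg c
    refine ⟨by positivity, ?_⟩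
    rw [hN] at hiN
    split_ifs at hiN with hz
    · nlinarith
    · have : i + 1 ≤ t * c := by omega
      nlinarith
  have hrep : ∀ x y, 0 ≤ y → y ≤ t * g * (g * x - h * y) →
      ∃ c i, 0 ≤ c ∧ 0 ≤ i ∧ i < N c ∧ x = X c + h * i ∧ y = Y c + g * i := by
    intro x y hy hyc
    have hc0 : 0 ≤ g * x - h * y := by
      by_contra hneg
      have : t * g * (g * x - h * y) < 0 := mul_neg_of_pos_of_neg htg (by omega)
      omega
    refine ⟨g * x - h * y, y / g, hc0, Int.ediv_nonneg hy hg0.le, ?_⟩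
    have hdm := Int.emod_add_mul_ediv y g
    have hyY : y % g = Y (g * x - h * y) := by
      apply hYuniq _ _ (Int.emod_nonneg _ (by omega)) (Int.emod_lt_of_pos _ hg0)
      refine ⟨x - h * (y / g), ?_⟩
      linear_combination h * hdm
    rw [hyY] at hdm
    generalize hc : g * x - h * y = c at *
    have hh0 := hY0 c
    refine ⟨?_, ?_, by linarith⟩
    · rw [hN]
      split_ifs with hz
      · rw [hz] at hdm
        have : g * (y / g) ≤ g * (t * c) := by linarith
        have := le_of_mul_le_mul_left this hg0
        omega
      · have : 0 < Y c := by omega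
        have : g * (y / g) < g * (t * c) := by linarith
        have := lt_of_mul_lt_mul_left this hg0.le
        omega
    · have h5 := hX c
      have : g * x = g * (X c + h * (y / g)) := by
        linear_combination hc - h5 - h * hdm
      exact mul_left_cancel₀ (by omega) this
  have hNpos : ∀ c, 0 ≤ c → 1 ≤ N c := by
    intro c hc
    rw [hN]
    split_ifs with hz
    · nlinarith
    · have : c ≠ 0 := by
        rintro rfl
        apply hz; rw [hY]; simp
      nlinarith [show 1 ≤ c by omega]
  have hFnn : ∀ c, 0 ≤ c → 0 ≤ F c := by
    intro c hc
    have := hmem c 0 le_rfl (by linarith [hNpos c hc])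
    have h2 := hnn _ _ this.1 this.2
    rw [hPt] at h2
    simpa using h2
  have hinj' : ∀ c i c' i', 0 ≤ i → i < N c → 0 ≤ i' → i' < N c' →
      F c + 3 * i = F c' + 3 * i' → c = c' ∧ i = i' := by
    intro c i c' i' hi hiN hi' hiN' heq
    have m1 := hmem c i hi hiN
    have m2 := hmem c' i' hi' hiN'
    have := hinj _ _ _ _ m1.1 m1.2 m2.1 m2.2 (by rw [hPt, hPt, heq])
    have k1 := hcc c i
    have k2 := hcc c' i'
    rw [this.1, this.2] at k1
    have : c = c' := k1.symm.trans k2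
    subst this
    exact ⟨rfl, by linarith⟩
  have hsurj' : ∀ j, 0 ≤ j → ∃ c i, 0 ≤ c ∧ 0 ≤ i ∧ i < N c ∧ F c + 3 * i = j := by
    intro j hj
    obtain ⟨x, y, hy, hyc, rfl⟩ := hsurj j hj
    obtain ⟨c, i, hc, hi, hiN, rfl, rfl⟩ := hrep x y hy hyc
    exact ⟨c, i, hc, hi, hiN, (hPt c i).symm⟩
  have hnext : ∀ c, 0 ≤ c → ∃ c', 0 ≤ c' ∧ F c' = F c + 3 * N c := by
    intro c hc
    have hNc := hNpos c hc
    obtain ⟨c', i, hc', hi, hiN, heq⟩ := hsurj' (F c + 3 * N c) (by linarith [hFnn c hc])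
    rcases hi.eq_or_lt with h0 | h0
    · exact ⟨c', hc', by rw [← heq, ← h0]; ring⟩
    · exfalso
      obtain ⟨rfl, h2⟩ := hinj' c' (i - 1) c (N c - 1) (by omega) (by omega) (by omega) (by omega)
        (by linarith)
      omega
  have hper : ∀ c k, Y (c + g * k) = Y c := by
    intro c k
    rw [hY, hY]
    have : -b * (c + g * k) = -b * c + g * (-b * k) := by ring
    rw [this, Int.add_mul_emod_self_left]
  have hstar : ∀ c, 3 * t * g + d + 2 * (Y (c + 3) - Y c) = 2 * g * (if Y c = 0 then 1 else 0) := by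
    intro c
    have key : ∀ c, 4 * |d| + 12 * g + 5 ≤ c →
        3 * t * g + d + 2 * (Y (c + 3) - Y c) = 2 * g * (if Y c = 0 then 1 else 0) := by
      intro c hc
      have hd0 := abs_nonneg d
      obtain ⟨c', hc', hF'⟩ := hnext c (by omega)
      have e1 := hgF c
      have e2 := hgF c'
      have hc3 : c' = c + 3 := by
        apply ts_asym t g d c c' (6 * (Y c' - Y c) - 6 * g * (if Y c = 0 then 1 else 0)) ht
          (by omega) hc' hc
        · have := hY0 c'
          have := hYg c
          split_ifs <;> linarith
        · have := hY0 c
          have := hYg c'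
          split_ifs <;> linarith
        · rw [hF', hN] at e2
          linear_combination e1 - e2
      subst hc3
      rw [hF', hN] at e2
      have : 3 * (3 * t * g + d + 2 * (Y (c + 3) - Y c)) = 3 * (2 * g * (if Y c = 0 then 1 else 0)) := by
        linear_combination e1 - e2
      linarith
    have hk := key (c + g * (4 * |d| + 12 * g + 5 + |c|)) (by
      have := abs_nonneg d
      have := abs_nonneg c
      have := neg_abs_le c
      nlinarith)
    rw [hper, show c + g * (4 * |d| + 12 * g + 5 + |c|) + 3
      = (c + 3) + g * (4 * |d| + 12 * g + 5 + |c|) by ring, hper] at hk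
    exact hk
  have hFrec : ∀ c, F (c + 3) = F c + 3 * N c := by
    intro c
    have e1 := hgF c
    have e2 := hgF (c + 3)
    have e3 := hstar c
    rw [hN]
    have : (2 * g) * F (c + 3) = (2 * g) * (F c + 3 * (t * c + if Y c = 0 then 1 else 0)) := by
      linear_combination e2 - e1 + 3 * e3
    exact mul_left_cancel₀ (by omega) this
  have hY00 : Y 0 = 0 := by rw [hY]; simp
  have hYh : Y (-h) = 1 := by
    symm; apply hYuniq <;> first | omega | simp
  have s0 := hstar 0
  have s1 := hstar (-h)
  rw [hY00] at s0
  rw [hYh] at s1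
  simp only [zero_add, if_true] at s0
  rw [if_neg (by norm_num)] at s1
  have b1 := hY0 (-h + 3)
  have b2 := hYg 3
  have hd : d = 2 - 3 * t * g := by linarith
  have hY3 : Y (-h + 3) = 0 := by linarith
  have hdiv : g ∣ 3 - h := by
    have := hYz (-h + 3)
    rwa [hY3, show -h + 3 + h * 0 = 3 - h by ring] at this
  refine ⟨?_, hdiv⟩
  have f0 := hgF 0
  have f1 := hgF 1
  have f2 := hgF 2
  rw [hY00] at f0
  have F0 : F 0 = f := by
    have : (2 * g) * F 0 = (2 * g) * f := by linarith
    exact mul_left_cancel₀ (by omega) this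
  have g1 : g * (F 1 + t - f) = 1 + 3 * Y 1 := by
    subst hd; linarith
  have g2 : g * (F 2 + t - f) = 2 + 3 * Y 2 := by
    subst hd; linarith
  have y10 := hY0 1
  have y11 := hYg 1
  have y20 := hY0 2
  have y21 := hYg 2
  have ha : F 1 + t - f = 1 ∨ F 1 + t - f = 2 := by
    have : 0 < F 1 + t - f := by
      by_contra hh
      nlinarith
    have : F 1 + t - f < 3 := by
      by_contra hh
      nlinarith
    omega
  have hb : F 2 + t - f = 1 ∨ F 2 + t - f = 2 := by
    have : 0 < F 2 + t - f := by
      by_contra hh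
      nlinarith
    have : F 2 + t - f < 3 := by
      by_contra hh
      nlinarith
    omega
  have hne : F 1 + t - f ≠ F 2 + t - f := by
    intro hh
    rw [hh] at g1
    omega
  have hsmall : ∀ j, 0 ≤ j → j ≤ 2 → j = F 0 ∨ j = F 1 ∨ j = F 2 := by
    intro j hj hj2
    obtain ⟨c, i, hc, hi, hiN, heq⟩ := hsurj' j hj
    have hi0 : i = 0 := by
      have := hFnn c hc
      omega
    have hc2 : c ≤ 2 := by
      by_contra hh
      have r := hFrec (c - 3)
      rw [sub_add_cancel] at r
      have := hFnn (c - 3) (by omega)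
      have := hNpos (c - 3) (by omega)
      omega
    have : c = 0 ∨ c = 1 ∨ c = 2 := by omega
    subst hi0
    rcases this with rfl | rfl | rfl <;> simp [← heq]
  have q0 := hsmall 0 (by omega) (by omega)
  have q1 := hsmall 1 (by omega) (by omega)
  have q2 := hsmall 2 (by omega) (by omega)
  clear hsmall hFrec hstar hper hnext hsurj' hinj' hFnn hNpos hrep hmem hcc hPt hgF hYuniq hYz
  omega

/-- The integer core of the backward direction. -/
theorem ts_backward (g h w : ℤ) (P : ℤ → ℤ → ℤ) (hg : 2 ≤ g) (h3 : ¬ (3 ∣ g))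
    (hw : h + w * g = 3)
    (hP : ∀ x y, 2 * P x y = 3 * (g * x - h * y) * (g * x - h * y - 3) + 2 * (x + w * y) + 4) :
    (∀ x y, 0 ≤ y → y ≤ 3 * g * (g * x - h * y) → 0 ≤ P x y) ∧
    (∀ x y x' y', 0 ≤ y → y ≤ 3 * g * (g * x - h * y) →
      0 ≤ y' → y' ≤ 3 * g * (g * x' - h * y') → P x y = P x' y' → x = x' ∧ y = y') ∧
    (∀ j, 0 ≤ j → ∃ x y, 0 ≤ y ∧ y ≤ 3 * g * (g * x - h * y) ∧ P x y = j) := by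
  have hg0 : 0 < g := by omega
  have hT : ∀ c : ℤ, ∃ T : ℤ, c * (c - 3) = 2 * T := by
    intro c
    rcases Int.even_or_odd' c with ⟨k, rfl | rfl⟩
    · exact ⟨k * (2 * k - 3), by ring⟩
    · exact ⟨(2 * k + 1) * (k - 1), by ring⟩
  choose T hT using hT
  -- change of coordinates
  have hq : ∀ x y, g * (x + w * y) = (g * x - h * y) + 3 * y := by
    intro x y; linear_combination y * hw
  have hPT : ∀ x y, P x y = 3 * T (g * x - h * y) + (x + w * y) + 2 := by
    intro x y
    have := hP x y
    have := hT (g * x - h * y)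
    linarith
  have hc0 : ∀ x y, 0 ≤ y → y ≤ 3 * g * (g * x - h * y) → 0 ≤ g * x - h * y := by
    intro x y hy hyc
    by_contra hneg
    have : 3 * g * (g * x - h * y) < 0 := mul_neg_of_pos_of_neg (by omega) (by omega)
    omega
  have hmod : ∀ c q c' q' y y' : ℤ, g * q = c + 3 * y → g * q' = c' + 3 * y' →
      3 ∣ q - q' → 3 ∣ c - c' := by
    rintro c q c' q' y y' e1 e2 ⟨k, hk⟩
    exact ⟨g * k - y + y', by linear_combination g * hk - e1 + e2⟩
  have hmain : ∀ c q y c' q' y' : ℤ, 0 ≤ c → 0 ≤ y → y ≤ 3 * g * c → 0 ≤ y' →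
      g * q = c + 3 * y → g * q' = c' + 3 * y' → c < c' → 3 * T c + q = 3 * T c' + q' → False := by
    intro c q y c' q' y' hc hy hyc hy' e1 e2 hlt heq
    have hd : 3 ∣ c - c' := hmod c q c' q' y y' e1 e2 ⟨T c' - T c, by linarith⟩
    have hc3 : c + 3 ≤ c' := by omega
    have t1 := hT c
    have t2 := hT c'
    have : c * (c + 3) ≤ c' * (c' - 3) := by nlinarith
    have h5 : 2 * T c + 6 * c ≤ 2 * T c' := by linarith
    have h6 : g * (T c + 3 * c) ≤ g * T c' := mul_le_mul_of_nonneg_left (by linarith) hg0.le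
    have h7 : g * (3 * T c + q) = g * (3 * T c' + q') := by rw [heq]
    linarith
  refine ⟨?_, ?_, ?_⟩
  · intro x y hy hyc
    have hc := hc0 x y hy hyc
    have e := hq x y
    rw [hPT]
    generalize g * x - h * y = c at *
    generalize x + w * y = q at *
    have t := hT c
    have hq0 : 0 ≤ q := by
      by_contra hh
      nlinarith
    rcases hc.eq_or_lt with h0 | h0
    · subst h0; omega
    · have hq1 : 0 < q := by
        by_contra hh
        nlinarith
      have : -2 ≤ c * (c - 3) := by nlinarith [sq_nonneg (2 * c - 3)]
      omega
  · intro x y x' y' hy hyc hy' hyc' heq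
    have hc := hc0 x y hy hyc
    have hc' := hc0 x' y' hy' hyc'
    have e := hq x y
    have e' := hq x' y'
    rw [hPT, hPT] at heq
    have hcc : g * x - h * y = g * x' - h * y' := by
      rcases lt_trichotomy (g * x - h * y) (g * x' - h * y') with hl | hl | hl
      · exact (hmain _ _ y _ _ y' hc hy hyc hy' e e' hl (by linarith)).elim
      · exact hl
      · exact (hmain _ _ y' _ _ y hc' hy' hyc' hy e' e hl (by linarith)).elim
    rw [hcc] at heq e
    have hqq : x + w * y = x' + w * y' := by linarith
    rw [hqq] at e
    have hyy : y = y' := by linarith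
    subst hyy
    exact ⟨by linarith, rfl⟩
  · intro v hv
    -- residue
    obtain ⟨c0, hc00, hc02, u, hu⟩ : ∃ c0 : ℤ, 0 ≤ c0 ∧ c0 ≤ 2 ∧ ∃ u, g * (v - 2) = c0 + 3 * u :=
      ⟨(g * (v - 2)) % 3, by omega, by omega, (g * (v - 2)) / 3, by omega⟩
    have hbase : c0 ≤ g * (v - 2 - 3 * T c0) := by
      have t := hT c0
      have : c0 = 0 ∨ c0 = 1 ∨ c0 = 2 := by omega
      rcases this with rfl | rfl | rfl
      · have hd : (3 : ℤ) ∣ g * (v - 2) := ⟨u, by linarith⟩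
        have hd2 : (3 : ℤ) ∣ v - 2 := (Int.prime_three.dvd_or_dvd hd).resolve_left h3
        have t0 : T 0 = 0 := by omega
        rw [t0]
        have : 0 ≤ v - 2 := by omega
        nlinarith
      · have t0 : T 1 = -1 := by omega
        rw [t0]; nlinarith
      · have t0 : T 2 = -1 := by omega
        rw [t0]; nlinarith
    have hT3 : ∀ c, T (c + 3) = T c + 3 * c := by
      intro c
      have t1 := hT c
      have t2 := hT (c + 3)
      have : 2 * T (c + 3) = 2 * (T c + 3 * c) := by linear_combination t1 - t2
      omega
    have hex : ∃ k : ℕ, c0 + 3 * k ≤ g * (v - 2 - 3 * T (c0 + 3 * k)) ∧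
        ¬ (c0 + 3 * k + 3 ≤ g * (v - 2 - 3 * T (c0 + 3 * k + 3))) := by
      by_contra hno
      push Not at hno
      have hall : ∀ k : ℕ, c0 + 3 * k ≤ g * (v - 2 - 3 * T (c0 + 3 * k)) := by
        intro k
        induction k with
        | zero => simpa using hbase
        | succ k ih =>
          have := hno k ih
          push_cast
          rw [show c0 + 3 * ((k : ℤ) + 1) = c0 + 3 * k + 3 by ring]
          exact this
      have hk := hall (v + 2).toNat
      have hcast : (((v + 2).toNat : ℕ) : ℤ) = v + 2 := Int.toNat_of_nonneg (by omega)
      rw [hcast] at hk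
      have t := hT (c0 + 3 * (v + 2))
      generalize hC : c0 + 3 * (v + 2) = C at *
      have hC1 : 6 + 3 * v ≤ C := by omega
      have hT1 : v ≤ T C := by nlinarith
      have : g * (v - 2 - 3 * T C) ≤ 0 := by
        apply mul_nonpos_of_nonneg_of_nonpos <;> linarith
      linarith
    obtain ⟨k, hk1, hk2⟩ := hex
    generalize hC : c0 + 3 * (k : ℤ) = c at *
    rw [hT3] at hk2
    have hcn : 0 ≤ c := by omega
    obtain ⟨y, hy⟩ : ∃ y, g * (v - 2 - 3 * T c) = c + 3 * y :=
      ⟨u - k - g * T c, by linear_combination hu + hC⟩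
    have hcc : g * (v - 2 - 3 * T c - w * y) - h * y = c := by
      linear_combination hy - y * hw
    refine ⟨v - 2 - 3 * T c - w * y, y, by linarith, ?_, ?_⟩
    · rw [hcc]
      have : 3 * (y - 3 * g * c) < 3 := by linarith
      linarith [show y - 3 * g * c < 1 by linarith]
    · rw [hPT, hcc]; ring

theorem ts_struct (n m : ℤ) (hn : 0 < n) (hm : 2 ≤ m) (hz : n ∣ (m - 1) ^ 2) :
    ∃ g h t : ℤ, 1 ≤ g ∧ 1 ≤ h ∧ 1 ≤ t ∧ IsCoprime g h ∧ n = t * g ^ 2 ∧ m = h * t * g + 1 := by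
  have hpos : 0 < Int.gcd n (m - 1) := Int.gcd_pos_of_ne_zero_left _ (by omega)
  obtain ⟨g, h, hgh, e1, e2⟩ := Int.exists_gcd_one hpos
  have hl : (0 : ℤ) < (Int.gcd n (m - 1) : ℤ) := by exact_mod_cast hpos
  generalize (Int.gcd n (m - 1) : ℤ) = l at *
  have hco : IsCoprime g h := Int.isCoprime_iff_gcd_eq_one.mpr hgh
  have hg : 0 < g := by
    by_contra hh
    nlinarith
  have hh : 0 < h := by
    by_contra hh
    nlinarith
  obtain ⟨z, hz⟩ := hz
  rw [e2, e1] at hz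
  have h1 : h ^ 2 * l = g * z := by
    have : l * (h ^ 2 * l) = l * (g * z) := by linear_combination hz
    exact mul_left_cancel₀ hl.ne' this
  have h2 : g ∣ h ^ 2 * l := ⟨z, h1⟩
  obtain ⟨t, ht⟩ := (hco.pow_right (n := 2)).dvd_of_dvd_mul_left h2
  refine ⟨g, h, t, hg, hh, ?_, hco, ?_, ?_⟩
  · by_contra hh
    nlinarith
  · rw [e1, ht]; ring
  · rw [ht] at e2; linear_combination e2

theorem ts_sector (g h t x y : ℤ) (hg : 1 ≤ g) (hh : 1 ≤ h) (ht : 1 ≤ t) :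
    (x, y) ∈ sectorLattice (t * g ^ 2) (h * t * g + 1) ↔
      0 ≤ y ∧ y ≤ t * g * (g * x - h * y) := by
  unfold sectorLattice
  simp only [Set.mem_setOf_eq]
  constructor
  · rintro ⟨h1, h2, h3⟩
    exact ⟨h2, by linarith⟩
  · rintro ⟨h2, h3⟩
    refine ⟨?_, h2, by linarith⟩
    have htg : 0 < t * g := by positivity
    by_contra hneg
    have h5 : g * x - h * y < 0 := by nlinarith
    have := mul_neg_of_pos_of_neg htg h5
    linarith

theorem ts_stair (g h t x y : ℤ) (c : ℕ) (hg : 1 ≤ g) (hh : 1 ≤ h) (ht : 1 ≤ t)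
    (hco : IsCoprime g h) :
    (x, y) ∈ staircase (t * g ^ 2) (h * t * g + 1) c ↔
      0 ≤ y ∧ y ≤ t * g * (g * x - h * y) ∧ g * x - h * y = c := by
  have htg : 0 < t * g := by positivity
  have hgcd : ((Int.gcd (t * g ^ 2) (h * t * g + 1 - 1) : ℕ) : ℤ) = t * g := by
    rw [show t * g ^ 2 = (t * g) * g by ring, show h * t * g + 1 - 1 = (t * g) * h by ring,
      Int.gcd_mul_left, Int.isCoprime_iff_gcd_eq_one.mp hco, mul_one, Int.natAbs_of_nonneg htg.le]
  unfold staircase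
  simp only [Set.mem_setOf_eq]
  rw [ts_sector g h t x y hg hh ht, hgcd, and_assoc]
  refine and_congr_right fun _ => and_congr_right fun _ => ?_
  constructor
  · intro h1
    have : (t * g) * (g * x - h * y) = (t * g) * c := by linear_combination -h1
    exact mul_left_cancel₀ htg.ne' this
  · intro h1
    linear_combination -(t * g) * h1

theorem ts_fwd_main (n m : ℤ) (hn : 0 < n) (hm : 2 ≤ m) (hnm : m < n) (p : ℝ → ℝ → ℝ)
    (hp : IsAscendingKStair n m 3 p) (hpk : IsPackingPolyOn p (sectorLattice n m)) :
    ∃ g h : ℤ, 1 ≤ h ∧ h < g ∧ IsCoprime g h ∧ n = 3 * g ^ 2 ∧ m = h * 3 * g + 1 ∧ g ∣ 3 - h := by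
  obtain ⟨⟨⟨d, e, f, hq⟩, hInt, -⟩, hasc⟩ := hp
  choose P hPz using hInt
  have hnR : (n : ℝ) ≠ 0 := by exact_mod_cast hn.ne'
  have hdvd : n ∣ (m - 1) ^ 2 := by
    refine ⟨P 0 2 - 2 * P 0 1 + P 0 0, ?_⟩
    have a0 := hPz 0 0
    have a1 := hPz 0 1
    have a2 := hPz 0 2
    rw [hq] at a0 a1 a2
    have : ((m : ℝ) - 1) ^ 2 = n * (P 0 2 - 2 * P 0 1 + P 0 0) := by
      rw [← a0, ← a1, ← a2]
      push_cast
      field_simp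
      ring
    exact_mod_cast this
  obtain ⟨g, h, t, hg, hh, ht, hco, hn', hm'⟩ := ts_struct n m hn hm hdvd
  subst hn' hm'
  have hgh : h < g := by
    by_contra hle
    have : t * g * g ≤ t * g * h := mul_le_mul_of_nonneg_left (by omega) (by positivity)
    nlinarith
  have hgR : (g : ℝ) ≠ 0 := by
    have : g ≠ 0 := by omega
    exact_mod_cast this
  have htR : (t : ℝ) ≠ 0 := by
    have : t ≠ 0 := by omega
    exact_mod_cast this
  have hq2 : ∀ x y : ℝ, 2 * p x y = t * (g * x - h * y) ^ 2 + 2 * d * x + 2 * e * y + 2 * f := by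
    intro x y
    rw [hq]
    push_cast
    field_simp
    ring
  have a00 := hq2 0 0
  have a10 := hq2 1 0
  have a01 := hq2 0 1
  have z00 := hPz 0 0
  have z10 := hPz 1 0
  have z01 := hPz 0 1
  push_cast at z00 z10 z01
  rw [z00] at a00
  rw [z10] at a10
  rw [z01] at a01
  have hde : d * h + e * g = 3 := by
    have hcons : ConsecutiveStairs (t * g ^ 2) (h * t * g + 1) (1, 0) (1 + h, g) := by
      refine ⟨g.toNat, ?_, ?_, ?_, ?_⟩
      · rw [ts_stair g h t _ _ _ hg hh ht hco, Int.toNat_of_nonneg (by omega)]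
        refine ⟨le_rfl, ?_, by ring⟩
        have : 0 ≤ t * g * g := by positivity
        linarith
      · rw [ts_stair g h t _ _ _ hg hh ht hco, Int.toNat_of_nonneg (by omega)]
        refine ⟨by omega, ?_, by ring⟩
        have : 1 ≤ t * g := by nlinarith
        nlinarith
      · intro heq
        have := congrArg Prod.snd heq
        simp at this
        omega
      · rintro ⟨x, y⟩ hxy
        rw [ts_stair g h t _ _ _ hg hh ht hco, Int.toNat_of_nonneg (by omega)] at hxy
        obtain ⟨k1, -, k3⟩ := hxy
        rintro ⟨l1, l2⟩
        rw [min_eq_left (by simp; omega)] at l1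
        rw [max_eq_right (by simp; omega)] at l2
        simp only at l1 l2
        have hd : g ∣ h * y := ⟨x - 1, by linear_combination -k3⟩
        obtain ⟨k, rfl⟩ := hco.dvd_of_dvd_mul_left hd
        have hx : x - 1 = h * k := by
          have : g * (x - 1) = g * (h * k) := by linear_combination k3
          exact mul_left_cancel₀ (by omega) this
        have : 0 < k := by
          by_contra hneg
          nlinarith
        nlinarith
    have := hasc _ _ hcons (by simp only; nlinarith)
    simp only at this
    push_cast at this
    have b1 := hq2 (1 + h) g
    have b2 := hq2 1 0
    linear_combination (1 / 2 : ℝ) * (2 * this - b1 + b2)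
  have hmain := ts_forward g h t (2 * (P 1 0 - P 0 0) - t * g ^ 2) (2 * (P 0 1 - P 0 0) - t * h ^ 2)
    (P 0 0) P (by omega) hh ht hco ?_ ?_ ?_ ?_ ?_
  · obtain ⟨rfl, hd⟩ := hmain
    exact ⟨g, h, hh, hgh, hco, rfl, rfl, hd⟩
  · intro x y
    have b := hq2 x y
    rw [hPz] at b
    have : (2 * P x y : ℝ) = t * (g * x - h * y) ^ 2 + (2 * (P 1 0 - P 0 0) - t * g ^ 2) * x
      + (2 * (P 0 1 - P 0 0) - t * h ^ 2) * y + 2 * P 0 0 := by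
      linear_combination b - x * (a10 - a00) - y * (a01 - a00) - a00
    exact_mod_cast this
  · have : ((2 * (P 1 0 - P 0 0) - t * g ^ 2) * h + (2 * (P 0 1 - P 0 0) - t * h ^ 2) * g : ℝ) = 6 := by
      linear_combination h * (a10 - a00) + g * (a01 - a00) + 2 * hde
    exact_mod_cast this
  · intro x y hy hyc
    obtain ⟨j, hj⟩ := hpk.1 (x, y) ((ts_sector g h t x y hg hh ht).mpr ⟨hy, hyc⟩)
    simp only [hPz] at hj
    have : P x y = (j : ℤ) := by exact_mod_cast hj
    omega
  · intro x y x' y' hy hyc hy' hyc' heq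
    have := hpk.2.1 ((ts_sector g h t x y hg hh ht).mpr ⟨hy, hyc⟩)
      ((ts_sector g h t x' y' hg hh ht).mpr ⟨hy', hyc'⟩) (by simp only [hPz, heq])
    simpa using this
  · intro j hj
    obtain ⟨⟨x, y⟩, hmem, hxy⟩ := hpk.2.2 j.toNat
    rw [ts_sector g h t x y hg hh ht] at hmem
    refine ⟨x, y, hmem.1, hmem.2, ?_⟩
    simp only [hPz] at hxy
    have : P x y = (j.toNat : ℤ) := by exact_mod_cast hxy
    omega

theorem ts_bwd_main (g h w : ℤ) (hg : 2 ≤ g) (hh : 1 ≤ h) (h3 : ¬ (3 ∣ g)) (hco : IsCoprime g h)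
    (hw : h + w * g = 3) :
    ∃ p : ℝ → ℝ → ℝ, IsAscendingKStair (3 * g ^ 2) (h * 3 * g + 1) 3 p ∧
      IsPackingPolyOn p (sectorLattice (3 * g ^ 2) (h * 3 * g + 1)) := by
  have hT : ∀ c : ℤ, ∃ T : ℤ, c * (c - 3) = 2 * T := by
    intro c
    rcases Int.even_or_odd' c with ⟨k, rfl | rfl⟩
    · exact ⟨k * (2 * k - 3), by ring⟩
    · exact ⟨(2 * k + 1) * (k - 1), by ring⟩
  choose T hT using hT
  obtain ⟨P, hP⟩ : ∃ P : ℤ → ℤ → ℤ, ∀ x y, 2 * P x y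
      = 3 * (g * x - h * y) * (g * x - h * y - 3) + 2 * (x + w * y) + 4 := by
    refine ⟨fun x y => 3 * T (g * x - h * y) + (x + w * y) + 2, fun x y => ?_⟩
    linear_combination -3 * hT (g * x - h * y)
  obtain ⟨p, hp⟩ : ∃ p : ℝ → ℝ → ℝ, ∀ x y, p x y
      = 3 / 2 * (g * x - h * y) * (g * x - h * y - 3) + (x + w * y) + 2 := ⟨_, fun _ _ => rfl⟩
  have hpP : ∀ x y : ℤ, p x y = P x y := by
    intro x y
    have : (2 * P x y : ℝ)
      = 3 * (g * x - h * y) * (g * x - h * y - 3) + 2 * (x + w * y) + 4 := by exact_mod_cast hP x y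
    rw [hp]
    linear_combination -(1 / 2 : ℝ) * this
  obtain ⟨c1, c2, c3⟩ := ts_backward g h w P hg h3 hw hP
  have hgR : (g : ℝ) ≠ 0 := by
    have : g ≠ 0 := by omega
    exact_mod_cast this
  have hstep : ∀ x y x' y' δ : ℤ, x' = x + h * δ → y' = y + g * δ → p x' y' - p x y = 3 * δ := by
    rintro x y x' y' δ rfl rfl
    have hwR : (h + w * g : ℝ) = 3 := by exact_mod_cast hw
    rw [hp, hp]
    push_cast
    linear_combination δ * hwR
  have hcons : ∀ x y x' y' : ℤ, ConsecutiveStairs (3 * g ^ 2) (h * 3 * g + 1) (x, y) (x', y') →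
      ∃ δ : ℤ, (δ = 1 ∨ δ = -1) ∧ x' = x + h * δ ∧ y' = y + g * δ ∧ 0 ≤ y ∧ 0 ≤ y' ∧
        0 ≤ x ∧ 0 ≤ x' := by
    rintro x y x' y' ⟨c, hr, hs, hne, hbt⟩
    have hx0 := hr.1.1
    have hx0' := hs.1.1
    rw [ts_stair g h 3 _ _ _ (by omega) hh (by omega) hco] at hr hs
    have hd : g ∣ h * (y' - y) := ⟨x' - x, by linear_combination hr.2.2 - hs.2.2⟩
    obtain ⟨δ, hδ⟩ := hco.dvd_of_dvd_mul_left hd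
    have hx : x' - x = h * δ := by
      have : g * (x' - x) = g * (h * δ) := by linear_combination hs.2.2 - hr.2.2 + h * hδ
      exact mul_left_cancel₀ (by omega) this
    refine ⟨δ, ?_, by linarith, by linarith, hr.1, hs.1, hx0, hx0'⟩
    have hδ0 : δ ≠ 0 := by
      rintro rfl
      apply hne
      ext <;> simp <;> linarith
    by_contra hcon
    have h2 : 2 ≤ δ ∨ δ ≤ -2 := by omega
    rcases h2 with h2 | h2
    · apply hbt (x + h, y + g)
      · rw [ts_stair g h 3 _ _ _ (by omega) hh (by omega) hco]
        have e : g * (x + h) - h * (y + g) = c := by linear_combination hr.2.2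
        rw [e]
        refine ⟨by linarith [hr.1], ?_, rfl⟩
        have := hs.2.1
        rw [hs.2.2] at this
        nlinarith
      · simp only
        have : h * 2 ≤ h * δ := mul_le_mul_of_nonneg_left h2 (by omega)
        rw [min_eq_left (by linarith), max_eq_right (by linarith)]
        constructor <;> linarith
    · apply hbt (x' + h, y' + g)
      · rw [ts_stair g h 3 _ _ _ (by omega) hh (by omega) hco]
        have e : g * (x' + h) - h * (y' + g) = c := by linear_combination hs.2.2
        rw [e]
        refine ⟨by linarith [hs.1], ?_, rfl⟩
        have := hr.2.1
        rw [hr.2.2] at this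
        nlinarith
      · simp only
        have : h * δ ≤ h * (-2) := mul_le_mul_of_nonneg_left h2 (by omega)
        rw [min_eq_right (by linarith), max_eq_left (by linarith)]
        constructor <;> linarith
  refine ⟨p, ⟨⟨?_, ?_, ?_⟩, ?_⟩, ?_, ?_, ?_⟩
  · refine ⟨1 - 9 / 2 * g, w + 9 / 2 * h, 2, fun x y => ?_⟩
    rw [hp]
    push_cast
    field_simp
    ring
  · exact fun a b => ⟨P a b, hpP a b⟩
  · rintro ⟨x, y⟩ ⟨x', y'⟩ hc
    obtain ⟨δ, hδ, e1, e2, -⟩ := hcons x y x' y' hc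
    have := hstep x y x' y' δ e1 e2
    simp only
    rcases hδ with rfl | rfl
    · right; push_cast at *; linarith
    · left; push_cast at *; linarith
  · rintro ⟨x, y⟩ ⟨x', y'⟩ hc hlt
    obtain ⟨δ, hδ, e1, e2, k1, k2, k3, k4⟩ := hcons x y x' y' hc
    have := hstep x y x' y' δ e1 e2
    simp only at *
    rcases hδ with rfl | rfl
    · push_cast at *; linarith
    · exfalso
      have a1 : x' ≤ x := by linarith
      have a2 : y' ≤ y := by linarith
      nlinarith
  · rintro ⟨x, y⟩ hxy
    rw [ts_sector g h 3 x y (by omega) hh (by omega)] at hxy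
    refine ⟨(P x y).toNat, ?_⟩
    have h0 := c1 x y hxy.1 hxy.2
    simp only [hpP]
    exact_mod_cast (Int.toNat_of_nonneg h0).symm
  · rintro ⟨x, y⟩ hxy ⟨x', y'⟩ hxy' heq
    rw [ts_sector g h 3 _ _ (by omega) hh (by omega)] at hxy hxy'
    simp only [hpP] at heq
    have := c2 x y x' y' hxy.1 hxy.2 hxy'.1 hxy'.2 (by exact_mod_cast heq)
    rw [this.1, this.2]
  · intro j
    obtain ⟨x, y, k1, k2, k3⟩ := c3 j (by omega)
    refine ⟨(x, y), (ts_sector g h 3 x y (by omega) hh (by omega)).mpr ⟨k1, k2⟩, ?_⟩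
    simp only [hpP, k3]
    simp

/-- For coprime positive integers `n`, `m` with `m ≥ 2` and `n/m > 1`,
there is an ascending 3-stair packing polynomial on `S(n/m)` if and only if either
(`m ≡ 10` or `19 (mod 27)` and `n = (m−1)²/27`), or `n/m = 12/7`. -/
theorem three_stair_classification (n m : ℕ) (hn : 0 < n) (hm : 2 ≤ m) (hnm : m < n)
    (hco : Nat.Coprime n m) :
    (∃ p : ℝ → ℝ → ℝ, IsAscendingKStair (n : ℤ) (m : ℤ) 3 p ∧
        IsPackingPolyOn p (sectorLattice (n : ℤ) (m : ℤ))) ↔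
    (((m ≡ 10 [MOD 27] ∨ m ≡ 19 [MOD 27]) ∧ 27 * n = (m - 1) ^ 2) ∨
      (n : ℚ) / (m : ℚ) = 12 / 7) := by
  constructor
  · rintro ⟨p, hp, hpk⟩
    obtain ⟨g, h, hh, hgh, hcop, e1, e2, hd⟩ := ts_fwd_main n m (by omega) (by omega) (by omega) p hp hpk
    rcases lt_trichotomy h 3 with h3 | h3 | h3
    · right
      have := Int.le_of_dvd (by omega) hd
      have hg2 : g = 2 := by omega
      have hh1 : h = 1 := by omega
      subst hg2 hh1
      have hn12 : n = 12 := by omega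
      have hm7 : m = 7 := by omega
      subst hn12 hm7
      norm_num
    · left
      subst h3
      have hg3 : ¬ (3 : ℤ) ∣ g := by
        intro hdv
        have := hcop.isUnit_of_dvd' hdv (dvd_refl 3)
        rw [Int.isUnit_iff] at this
        omega
      refine ⟨?_, ?_⟩
      · unfold Nat.ModEq
        omega
      · obtain ⟨k, rfl⟩ : ∃ k, m = k + 1 := ⟨m - 1, by omega⟩
        rw [Nat.add_sub_cancel]
        zify
        have : (k : ℤ) = 9 * g := by push_cast at e2; linarith
        rw [this, e1]; ring
    · exfalso
      have : g ∣ h - 3 := by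
        have := (dvd_neg (a := g) (b := 3 - h)).mpr hd
        rwa [neg_sub] at this
      have := Int.le_of_dvd (by omega) this
      omega
  · rintro (⟨hmod, heq⟩ | heq)
    · obtain ⟨g, hg⟩ : ∃ g, m = 9 * g + 1 := ⟨m / 9, by unfold Nat.ModEq at hmod; omega⟩
      subst hg
      rw [Nat.add_sub_cancel] at heq
      have hn3 : n = 3 * g ^ 2 := by nlinarith
      subst hn3
      have hg3 : ¬ (3 : ℤ) ∣ (g : ℤ) := by unfold Nat.ModEq at hmod; omega
      have hg2 : 2 ≤ g := by
        by_contra hlt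
        have : g = 0 ∨ g = 1 := by omega
        rcases this with rfl | rfl <;> omega
      have := ts_bwd_main g 3 0 (by omega) (by norm_num) hg3
        ((Int.prime_three.coprime_iff_not_dvd.mpr hg3).symm) (by ring)
      rw [show (3 * 3 * (g : ℤ) + 1) = ((9 * g + 1 : ℕ) : ℤ) by push_cast; ring,
        show (3 * (g : ℤ) ^ 2) = ((3 * g ^ 2 : ℕ) : ℤ) by push_cast; ring] at this
      exact this
    · have hmQ : (m : ℚ) ≠ 0 := by
        have : m ≠ 0 := by omega
        exact_mod_cast this
      rw [div_eq_div_iff hmQ (by norm_num)] at heq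
      have heq' : n * 7 = 12 * m := by exact_mod_cast heq
      have hd : m ∣ 7 := by
        apply (Nat.Coprime.dvd_of_dvd_mul_left hco.symm)
        exact ⟨12, by linarith⟩
      have hm7 : m = 7 := by
        rcases (Nat.dvd_prime (by norm_num)).mp hd with h | h <;> omega
      have hn12 : n = 12 := by omega
      subst hm7 hn12
      have := ts_bwd_main 2 1 1 (by norm_num) (by norm_num) (by norm_num)
        isCoprime_one_right (by norm_num)
      norm_num at this
      exact_mod_cast this
end

section
/- Let m, n be coprime positive integers with m ≥ 2, n/m > 1, and n dividing (m−1)². There is no 4-stair packing polynomial on S(n/m). -/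
lemma tri_two (c : ℤ) : 2 * (c * (c - 1) / 2) = c * (c - 1) := by
  have h : (2 : ℤ) ∣ c * (c - 1) := by
    have := Int.even_mul_pred_self c
    exact this.two_dvd
  exact Int.mul_ediv_cancel' h

lemma floor_diff (r b c c' : ℤ) (hb : 0 < b) :
    |r * c' / b - r * c / b| ≤ |r| * |c' - c| + 1 := by
  have e1 := Int.emod_add_mul_ediv (r * c) b
  have e2 := Int.emod_add_mul_ediv (r * c') b
  have p1 := Int.emod_nonneg (r * c) hb.ne'
  have p2 := Int.emod_nonneg (r * c') hb.ne'
  have q1 := Int.emod_lt_of_pos (r * c) hb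
  have q2 := Int.emod_lt_of_pos (r * c') hb
  rw [← abs_mul]
  set u := r * c / b
  set v := r * c' / b
  have k1 : r * (c' - c) ≤ |r * (c' - c)| := le_abs_self _
  have k2 : -(r * (c' - c)) ≤ |r * (c' - c)| := neg_le_abs _
  have k0 : 0 ≤ |r * (c' - c)| := abs_nonneg _
  set Y := |r * (c' - c)|
  have k3 : Y ≤ b * Y := by nlinarith
  rw [abs_le]
  constructor
  · by_contra hh
    push Not at hh
    have : b * (v - u) ≤ b * (-(Y + 1) - 1) := by
      apply mul_le_mul_of_nonneg_left _ hb.le; omega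
    nlinarith
  · by_contra hh
    push Not at hh
    have : b * ((Y + 1) + 1) ≤ b * (v - u) := by
      apply mul_le_mul_of_nonneg_left _ hb.le; omega
    nlinarith

lemma next_four (r b t s f : ℤ) (hb : 0 < b) (ht : 0 < t) (A : ℤ → ℤ)
    (hA : ∀ c, 2 * A c = t * (c * (c - 1)) + 2 * s * c + 2 * f - 8 * (r * c / b))
    (c c' δ : ℤ) (hc' : 0 ≤ c') (h0 : 0 ≤ δ) (h1 : δ ≤ 1)
    (hc : 10 * (|s| + 4 * |r|) + 20 ≤ c)
    (hE : A c' = A c + 4 * (t * c + δ)) : c' = c + 4 := by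
  have a1 := hA c
  have a2 := hA c'
  have fd := floor_diff r b c c' hb
  set G := r * c' / b - r * c / b with hG
  have g1 := (abs_le.mp fd).1
  have g2 := (abs_le.mp fd).2
  set h := c' - c with hh
  have hs1 : s * h ≤ |s| * |h| := by rw [← abs_mul]; exact le_abs_self _
  have hs2 : -(s * h) ≤ |s| * |h| := by rw [← abs_mul]; exact neg_le_abs _
  have hs := abs_nonneg s
  have hr := abs_nonneg r
  set M := |s| + 4 * |r| with hM
  have hMn : 0 ≤ M := by positivity
  have hc'e : c' = c + h := by omega
  have key : t * (h * (2 * c + h - 1)) + 2 * (s * h) - 8 * G = 8 * (t * c + δ) := by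
    have : t * (c' * (c' - 1)) - t * (c * (c - 1)) = t * (h * (2 * c + h - 1)) := by
      rw [hc'e]; ring
    have : 2 * s * c' - 2 * s * c = 2 * (s * h) := by rw [hc'e]; ring
    linarith
  have up : t * (h * (2 * c + h - 1)) ≤ 8 * (t * c + δ) + 2 * M * |h| + 8 := by
    rw [hM]; linarith
  have lo : 8 * (t * c + δ) ≤ t * (h * (2 * c + h - 1)) + 2 * M * |h| + 8 := by
    rw [hM]; linarith
  have htc : c ≤ t * c := by nlinarith
  by_contra hne
  have : h ≤ 0 ∨ h = 1 ∨ h = 2 ∨ h = 3 ∨ 5 ≤ h := by omega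
  rcases this with h1 | h1 | h1 | h1 | h1
  · rw [abs_of_nonpos h1] at lo
    -- h ≤ 0, 2c+h-1 = c + c' - 1 ≥ c - 1
    have x1 : c - 1 ≤ 2 * c + h - 1 := by omega
    have x2 : (-h) * (c - 1) ≤ (-h) * (2 * c + h - 1) :=
      mul_le_mul_of_nonneg_left x1 (by omega)
    have x3 : (-h) * (2 * c + h - 1) ≤ t * ((-h) * (2 * c + h - 1)) := by
      have : 0 ≤ (-h) * (2 * c + h - 1) := mul_nonneg (by omega) (by omega)
      nlinarith
    have x4 : (-h) * (2 * M) ≤ (-h) * (c - 1) :=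
      mul_le_mul_of_nonneg_left (by omega) (by omega)
    nlinarith
  · rw [h1] at lo; norm_num at lo; nlinarith
  · rw [h1] at lo; norm_num at lo; nlinarith
  · rw [h1] at lo; norm_num at lo; nlinarith
  · rw [abs_of_nonneg (by omega)] at up
    have x1 : h * (2 * (t * c)) ≤ t * (h * (2 * c + h - 1)) := by
      have : 0 ≤ t * (h * (h - 1)) := by
        apply mul_nonneg ht.le; apply mul_nonneg <;> omega
      nlinarith
    have x2 : 5 * (2 * (t * c) - 2 * M) ≤ h * (2 * (t * c) - 2 * M) :=
      mul_le_mul_of_nonneg_right h1 (by omega)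
    nlinarith

lemma tele (g : ℤ → ℤ) (k : ℕ) :
    ∑ i ∈ Finset.range k, (g ((i : ℤ) + 4) - g i) =
      (g k + g (k + 1) + g (k + 2) + g (k + 3)) - (g 0 + g 1 + g 2 + g 3) := by
  induction k with
  | zero => simp
  | succ k ih =>
    rw [Finset.sum_range_succ, ih]
    push_cast
    have e1 : (k : ℤ) + 1 + 1 = k + 2 := by ring
    have e2 : (k : ℤ) + 1 + 2 = k + 3 := by ring
    have e3 : (k : ℤ) + 1 + 3 = k + 4 := by ring
    rw [e1, e2, e3]; ring

lemma ind_sum (b : ℕ) (hb : 0 < b) :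
    ∑ i ∈ Finset.range b, (if (b : ℤ) ∣ (i : ℤ) then (1 : ℤ) else 0) = 1 := by
  rw [Finset.sum_eq_single 0]
  · simp
  · intro i hi h0
    rw [if_neg]
    intro hd
    have := Int.natCast_dvd_natCast.mp hd
    have := Nat.le_of_dvd (Nat.pos_of_ne_zero h0) this
    simp at hi; omega
  · simp; omega

lemma core_A (r b t s f : ℤ) (hb : 0 < b) (ht : 0 < t) (A δ : ℤ → ℤ)
    (hA : ∀ c, 2 * A c = t * (c * (c - 1)) + 2 * s * c + 2 * f - 8 * (r * c / b))
    (hδ : ∀ c, δ c = if b ∣ c then 1 else 0)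
    (hpos : ∀ c j, 0 ≤ c → 0 ≤ j → j < t * c + δ c → 0 ≤ A c + 4 * j)
    (hinj : ∀ c j c' j', 0 ≤ c → 0 ≤ j → j < t * c + δ c → 0 ≤ c' → 0 ≤ j' →
      j' < t * c' + δ c' → A c + 4 * j = A c' + 4 * j' → c = c' ∧ j = j')
    (hsur : ∀ z, 0 ≤ z → ∃ c j, 0 ≤ c ∧ 0 ≤ j ∧ j < t * c + δ c ∧ A c + 4 * j = z) :
    False := by
  have d0 : ∀ c, 0 ≤ δ c := by intro c; rw [hδ]; split_ifs <;> norm_num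
  have d1 : ∀ c, δ c ≤ 1 := by intro c; rw [hδ]; split_ifs <;> norm_num
  have hN : ∀ c, 0 ≤ c → 1 ≤ t * c + δ c := by
    intro c hc
    rcases hc.eq_or_lt with h | h
    · subst h; rw [hδ]; simp
    · have := d0 c; nlinarith
  have hAinj : ∀ c c', 0 ≤ c → 0 ≤ c' → A c = A c' → c = c' := by
    intro c c' h h' e
    exact (hinj c 0 c' 0 h le_rfl (by have := hN c h; omega) h' le_rfl
      (by have := hN c' h'; omega) (by omega)).1
  have hnext : ∀ c, 0 ≤ c → ∃ c', 0 ≤ c' ∧ A c' = A c + 4 * (t * c + δ c) := by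
    intro c hc
    have p0 := hpos c (t * c + δ c - 1) hc (by have := hN c hc; omega) (by omega)
    obtain ⟨c', j', hc', hj', hlt, e⟩ := hsur (A c + 4 * (t * c + δ c)) (by omega)
    rcases hj'.eq_or_lt with h | h
    · exact ⟨c', hc', by omega⟩
    · obtain ⟨x1, x2⟩ := hinj c' (j' - 1) c (t * c + δ c - 1) hc' (by omega) (by omega) hc
        (by have := hN c hc; omega) (by omega) (by omega)
      subst x1; omega
  have hlarge : ∀ c, 10 * (|s| + 4 * |r|) + 20 ≤ c → A (c + 4) = A c + 4 * (t * c + δ c) := by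
    intro c hc
    have hc0 : 0 ≤ c := by have := abs_nonneg s; have := abs_nonneg r; omega
    obtain ⟨c', hc', e⟩ := hnext c hc0
    have := next_four r b t s f hb ht A hA c c' (δ c) hc' (d0 c) (d1 c) hc e
    rw [← this]; exact e
  have hrel0 : ∀ c, A (c + 4) = A c + 4 * (t * c + δ c) ↔
      3 * t + 2 * s = 2 * (r * (c + 4) / b - r * c / b + δ c) := by
    intro c
    have a1 := hA c
    have a2 := hA (c + 4)
    have : t * ((c + 4) * (c + 4 - 1)) = t * (c * (c - 1)) + 8 * (t * c) + 12 * t := by ring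
    have : 2 * s * (c + 4) = 2 * s * c + 8 * s := by ring
    omega
  have hrel : ∀ c, 3 * t + 2 * s = 2 * (r * (c + 4) / b - r * c / b + δ c) := by
    intro c
    set K := 10 * (|s| + 4 * |r|) + 20 + |c| with hK
    have hbig : 10 * (|s| + 4 * |r|) + 20 ≤ c + b * K := by
      have h1 := neg_abs_le c
      have h2 : 0 ≤ |s| := abs_nonneg s
      have h3 : 0 ≤ |r| := abs_nonneg r
      have h4 := abs_nonneg c
      have : K ≤ b * K := by nlinarith
      omega
    have h := (hrel0 _).1 (hlarge _ hbig)
    have e1 : r * (c + b * K + 4) / b = r * (c + 4) / b + r * K := by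
      rw [show r * (c + b * K + 4) = r * (c + 4) + (r * K) * b by ring,
        Int.add_mul_ediv_right _ _ hb.ne']
    have e2 : r * (c + b * K) / b = r * c / b + r * K := by
      rw [show r * (c + b * K) = r * c + (r * K) * b by ring,
        Int.add_mul_ediv_right _ _ hb.ne']
    have e3 : δ (c + b * K) = δ c := by
      rw [hδ, hδ]
      simp only [Int.dvd_add_left (Dvd.intro K rfl : b ∣ b * K)]
    rw [e1, e2, e3] at h
    linarith
  have hA4 : ∀ c, A (c + 4) = A c + 4 * (t * c + δ c) := fun c => (hrel0 c).2 (hrel c)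
  obtain ⟨v, hv⟩ : ∃ v, t = 2 * v := ⟨t / 2, by have := hrel 0; omega⟩
  set κ := 3 * v + s with hκ
  have hrel2 : ∀ c, r * (c + 4) / b - r * c / b + δ c = κ := by
    intro c; have := hrel c; omega
  -- summation
  have hsum : 4 * r + 1 = b * κ := by
    obtain ⟨B, rfl⟩ := Int.eq_ofNat_of_zero_le hb.le
    have hB : 0 < B := by exact_mod_cast hb
    have s1 := tele (fun c => r * c / (B : ℤ)) B
    have s2 := ind_sum B hB
    have s3 : ∑ i ∈ Finset.range B, ((r * ((i : ℤ) + 4) / (B : ℤ) - r * i / B) +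
        (if (B : ℤ) ∣ (i : ℤ) then (1 : ℤ) else 0)) = B * κ := by
      rw [Finset.sum_congr rfl (fun (i : ℕ) _ => show _ = κ by rw [← hδ]; exact hrel2 i)]
      simp
    rw [Finset.sum_add_distrib, s2] at s3
    rw [s1] at s3
    have e : ∀ i : ℤ, r * ((B : ℤ) + i) / B = r * i / B + r := by
      intro i
      rw [show r * ((B : ℤ) + i) = r * i + r * B by ring, Int.add_mul_ediv_right _ _ hb.ne']
    have e0 := e 0
    rw [add_zero] at e0
    rw [e0, e 1, e 2, e 3] at s3
    linarith
  have bound : ∀ i : ℤ, 1 ≤ i → i ≤ 3 →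
      1 ≤ i * κ - 4 * (r * i / b) ∧ i * κ - 4 * (r * i / b) ≤ 3 := by
    intro i hi1 hi3
    have e1 := Int.emod_add_mul_ediv (r * i) b
    have p1 := Int.emod_nonneg (r * i) hb.ne'
    have q1 := Int.emod_lt_of_pos (r * i) hb
    set ρ := (r * i) % b
    set g := r * i / b
    have e : b * (i * κ - 4 * g) = i + 4 * ρ := by linear_combination (-i) * hsum - 4 * e1
    constructor
    · by_contra hh
      push Not at hh
      have : b * (i * κ - 4 * g) ≤ b * 0 := mul_le_mul_of_nonneg_left (by omega) hb.le
      omega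
    · by_contra hh
      push Not at hh
      have : b * 4 ≤ b * (i * κ - 4 * g) := mul_le_mul_of_nonneg_left (by omega) hb.le
      omega
  have b1 := bound 1 (by norm_num) (by norm_num)
  have b2 := bound 2 (by norm_num) (by norm_num)
  have b3 := bound 3 (by norm_num) (by norm_num)
  have A0 := hA 0
  have A1 := hA 1
  have A2 := hA 2
  have A3 := hA 3
  norm_num at A0 A1 A2 A3 b1 b2 b3
  have n01 : A 0 ≠ A 1 := fun h => by have := hAinj 0 1 (by norm_num) (by norm_num) h; omega
  have n02 : A 0 ≠ A 2 := fun h => by have := hAinj 0 2 (by norm_num) (by norm_num) h; omega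
  have n03 : A 0 ≠ A 3 := fun h => by have := hAinj 0 3 (by norm_num) (by norm_num) h; omega
  have n12 : A 1 ≠ A 2 := fun h => by have := hAinj 1 2 (by norm_num) (by norm_num) h; omega
  have n13 : A 1 ≠ A 3 := fun h => by have := hAinj 1 3 (by norm_num) (by norm_num) h; omega
  have n23 : A 2 ≠ A 3 := fun h => by have := hAinj 2 3 (by norm_num) (by norm_num) h; omega
  by_cases hv2 : 2 ≤ v
  · have P2 := hpos 2 0 (by norm_num) le_rfl (by have := hN 2 (by norm_num); omega)
    obtain ⟨c, j, hc, hj, hlt, e⟩ := hsur (A 0 - 4) (by omega)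
    by_cases hj1 : j + 1 < t * c + δ c
    · have := hinj c (j + 1) 0 0 hc (by omega) hj1 le_rfl le_rfl
        (by have := hN 0 le_rfl; omega) (by omega)
      omega
    · have e4 := hA4 c
      have : j + 1 = t * c + δ c := by omega
      have := hAinj (c + 4) 0 (by omega) le_rfl (by omega)
      omega
  · omega

lemma core_V (w b t s f : ℤ) (hb : 0 < b) (ht : 0 < t) (hco : IsCoprime w b) (V : ℤ → ℤ → ℤ)
    (hV : ∀ c k, 2 * V c k = t * (c * (c - 1)) + 2 * s * c + 8 * k + 2 * f)
    (hpos : ∀ c k, 0 ≤ c * w + k * b → c * w + k * b ≤ b * t * c → 0 ≤ V c k)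
    (hinj : ∀ c k c' k', 0 ≤ c * w + k * b → c * w + k * b ≤ b * t * c →
      0 ≤ c' * w + k' * b → c' * w + k' * b ≤ b * t * c' → V c k = V c' k' → c = c' ∧ k = k')
    (hsur : ∀ z, 0 ≤ z → ∃ c k, 0 ≤ c * w + k * b ∧ c * w + k * b ≤ b * t * c ∧ V c k = z) :
    False := by
  have region : ∀ c j : ℤ, (0 ≤ c * w + (j - w * c / b) * b ∧
      c * w + (j - w * c / b) * b ≤ b * t * c) ↔
      (0 ≤ c ∧ 0 ≤ j ∧ j < t * c + if b ∣ c then 1 else 0) := by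
    intro c j
    have e1 := Int.emod_add_mul_ediv (w * c) b
    have p1 := Int.emod_nonneg (w * c) hb.ne'
    have q1 := Int.emod_lt_of_pos (w * c) hb
    have z : (w * c) % b = 0 ↔ b ∣ c := by
      rw [← Int.dvd_iff_emod_eq_zero]
      exact ⟨fun h => hco.symm.dvd_of_dvd_mul_left h, fun h => h.mul_left _⟩
    set ρ := (w * c) % b
    set g := w * c / b
    have e : c * w + (j - g) * b = ρ + b * j := by linear_combination -e1
    rw [e]
    constructor
    · rintro ⟨h1, h2⟩
      have hj : 0 ≤ j := by
        by_contra hh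
        have : b * j ≤ b * (-1) := mul_le_mul_of_nonneg_left (by omega) hb.le
        omega
      have hbj : 0 ≤ b * j := by positivity
      have hc : 0 ≤ c := by
        by_contra hh
        have : b * t * c < 0 := mul_neg_of_pos_of_neg (by positivity) (by omega)
        omega
      refine ⟨hc, hj, ?_⟩
      split_ifs with hd
      · by_contra hh
        have : b * (t * c + 1) ≤ b * j := mul_le_mul_of_nonneg_left (by omega) hb.le
        nlinarith
      · have : ρ ≠ 0 := fun h => hd (z.1 h)
        by_contra hh
        have : b * (t * c) ≤ b * j := mul_le_mul_of_nonneg_left (by omega) hb.le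
        have : 0 < ρ := by omega
        nlinarith
    · rintro ⟨hc, hj, h⟩
      have hbj : 0 ≤ b * j := by positivity
      refine ⟨by omega, ?_⟩
      split_ifs at h with hd
      · have := z.2 hd
        have : b * j ≤ b * (t * c) := mul_le_mul_of_nonneg_left (by omega) hb.le
        nlinarith
      · have : b * j ≤ b * (t * c - 1) := mul_le_mul_of_nonneg_left (by omega) hb.le
        nlinarith
  have hVA : ∀ c j, V c (j - w * c / b) = V c (-(w * c / b)) + 4 * j := by
    intro c j
    have := hV c (j - w * c / b)
    have := hV c (-(w * c / b))
    omega
  refine core_A w b t s f hb ht (fun c => V c (-(w * c / b))) (fun c => if b ∣ c then 1 else 0)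
    ?_ (fun _ => rfl) ?_ ?_ ?_
  · intro c
    have := hV c (-(w * c / b))
    omega
  · intro c j h1 h2 h3
    obtain ⟨r1, r2⟩ := (region c j).2 ⟨h1, h2, h3⟩
    have := hpos _ _ r1 r2
    rw [hVA] at this
    exact this
  · intro c j c' j' h1 h2 h3 h1' h2' h3' e
    obtain ⟨r1, r2⟩ := (region c j).2 ⟨h1, h2, h3⟩
    obtain ⟨r1', r2'⟩ := (region c' j').2 ⟨h1', h2', h3'⟩
    obtain ⟨x, y⟩ := hinj _ _ _ _ r1 r2 r1' r2' (by rw [hVA, hVA]; exact e)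
    subst x
    exact ⟨rfl, by omega⟩
  · intro z hz
    obtain ⟨c, k, r1, r2, e⟩ := hsur z hz
    have ek : (k + w * c / b) - w * c / b = k := by ring
    obtain ⟨a1, a2, a3⟩ := (region c (k + w * c / b)).1 (by rw [ek]; exact ⟨r1, r2⟩)
    refine ⟨c, k + w * c / b, a1, a2, a3, ?_⟩
    rw [← hVA, ek, e]

lemma decomp (n m : ℕ) (hn : 0 < n) (hm : 2 ≤ m) (hdvd : n ∣ (m - 1) ^ 2) :
    ∃ a b t : ℤ, 0 < a ∧ 0 < b ∧ 0 < t ∧ IsCoprime a b ∧ (n : ℤ) = b * b * t ∧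
      (m : ℤ) = a * b * t + 1 ∧ (Int.gcd (n : ℤ) ((m : ℤ) - 1) : ℤ) = b * t := by
  obtain ⟨q, rfl⟩ : ∃ q, m = q + 1 := ⟨m - 1, by omega⟩
  simp only [Nat.add_sub_cancel] at hdvd
  have hq : 0 < q := by omega
  have hl : 0 < Nat.gcd n q := Nat.gcd_pos_of_pos_left _ hn
  obtain ⟨b, hb⟩ := Nat.gcd_dvd_left n q
  obtain ⟨a, ha⟩ := Nat.gcd_dvd_right n q
  have hab : Nat.Coprime b a := by
    have := Nat.coprime_div_gcd_div_gcd hl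
    rwa [Nat.div_eq_of_eq_mul_right hl hb, Nat.div_eq_of_eq_mul_right hl ha] at this
  have hg : Int.gcd (n : ℤ) (((q + 1 : ℕ) : ℤ) - 1) = Nat.gcd n q := by
    push_cast; rw [add_sub_cancel_right]; rfl
  rw [hg]
  set l := Nat.gcd n q
  have hbl : b ∣ l := by
    rw [hb, ha, show (l * a) ^ 2 = l * (l * a ^ 2) by ring] at hdvd
    have h2 := Nat.dvd_of_mul_dvd_mul_left hl hdvd
    exact (Nat.Coprime.pow_right 2 hab).dvd_of_dvd_mul_right h2
  obtain ⟨t, htt⟩ := hbl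
  rw [htt] at ha hb hl
  refine ⟨a, b, t, ?_, ?_, ?_, ?_, ?_, ?_, ?_⟩
  · rcases Nat.eq_zero_or_pos a with h | h
    · subst h; simp at ha; omega
    · exact_mod_cast h
  · exact_mod_cast Nat.pos_of_mul_pos_right hl
  · exact_mod_cast Nat.pos_of_mul_pos_left hl
  · exact (Nat.isCoprime_iff_coprime.2 hab).symm
  · rw [hb]; push_cast; ring
  · rw [ha]; push_cast; ring
  · rw [htt]; push_cast; ring

/-- For coprime positive integers `n`, `m` with `m ≥ 2`, `n/m > 1`, and
`n ∣ (m−1)²`, there is no 4-stair packing polynomial on `S(n/m)`. -/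
theorem no_four_stair (n m : ℕ) (hn : 0 < n) (hm : 2 ≤ m) (hnm : m < n)
    (hco : Nat.Coprime n m) (hdvd : n ∣ (m - 1) ^ 2) :
    ¬ ∃ p : ℝ → ℝ → ℝ, IsKStair (n : ℤ) (m : ℤ) 4 p ∧
        IsPackingPolyOn p (sectorLattice (n : ℤ) (m : ℤ)) := by
  rintro ⟨p, ⟨⟨d, e, f, hp⟩, hint, hstair⟩, hnat, hinj, hsur⟩
  obtain ⟨a, b, t, ha, hb, ht, hab, hnn, hmm, hl⟩ := decomp n m hn hm hdvd
  have hbR : (b : ℝ) ≠ 0 := by exact_mod_cast hb.ne'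
  have htR : (t : ℝ) ≠ 0 := by exact_mod_cast ht.ne'
  have hp' : ∀ x y : ℝ, p x y = (t : ℝ) / 2 * (b * x - a * y) ^ 2 + d * x + e * y + f := by
    intro x y
    rw [hp, hnn, hmm]
    push_cast
    field_simp
    ring
  -- sector in new coordinates
  obtain ⟨u, w, huw⟩ : ∃ u w : ℤ, b * u - a * w = 1 := by
    obtain ⟨α, β, h⟩ := hab
    exact ⟨β, -α, by linear_combination h⟩
  have hsec : ∀ c k : ℤ, ((c * u + k * a, c * w + k * b) : ℤ × ℤ) ∈ sectorLattice n m ↔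
      (0 ≤ c * w + k * b ∧ c * w + k * b ≤ b * t * c) := by
    intro c k
    simp only [sectorLattice, Set.mem_setOf_eq]
    rw [hnn, hmm]
    have key : b * b * t * (c * u + k * a) - (a * b * t + 1) * (c * w + k * b) =
        b * t * c - (c * w + k * b) := by
      linear_combination (b * t * c) * huw
    constructor
    · rintro ⟨h1, h2, h3⟩
      exact ⟨h2, by linarith⟩
    · rintro ⟨h2, h3⟩
      refine ⟨?_, h2, by linarith⟩
      have hc : 0 ≤ c := by
        by_contra hh
        have : b * t * c < 0 := mul_neg_of_pos_of_neg (by positivity) (by omega)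
        omega
      have : b * (c * u + k * a) = c + a * (c * w + k * b) := by
        linear_combination c * huw
      have h5 : 0 ≤ a * (c * w + k * b) := mul_nonneg ha.le h2
      by_contra hh
      have : b * (c * u + k * a) < 0 := mul_neg_of_pos_of_neg hb (by omega)
      omega
  have hpar : ∀ P : ℤ × ℤ, ∃ c k : ℤ, P = (c * u + k * a, c * w + k * b) := by
    rintro ⟨x, y⟩
    refine ⟨b * x - a * y, u * y - w * x, ?_⟩
    ext
    · simp only; linear_combination (-x) * huw
    · simp only; linear_combination (-y) * huw
  have huwR : (b : ℝ) * u - a * w = 1 := by exact_mod_cast huw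
  -- the stair condition
  have hstep : d * a + e * b = 4 ∨ d * a + e * b = -4 := by
    have hcons : ConsecutiveStairs (n : ℤ) (m : ℤ) (1 + a, b) (1, 0) := by
      refine ⟨b.toNat, ?_, ?_, ?_, ?_⟩
      · refine ⟨?_, ?_⟩
        · refine ⟨by simp only; omega, hb.le, ?_⟩
          simp only
          rw [hnn, hmm]
          have : b * 1 ≤ b * (b * t) := mul_le_mul_of_nonneg_left (by nlinarith) hb.le
          nlinarith
        · simp only
          rw [hl, hnn, hmm, Int.toNat_of_nonneg hb.le]; ring
      · refine ⟨?_, ?_⟩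
        · refine ⟨by norm_num, le_rfl, ?_⟩
          simp
        · simp only
          rw [hl, hnn, hmm, Int.toNat_of_nonneg hb.le]; ring
      · intro h
        have := congrArg Prod.snd h
        simp at this; omega
      · rintro ⟨x, y⟩ ⟨-, h⟩ ⟨h1, h2⟩
        simp only at h h1 h2
        rw [hl, hnn, hmm, Int.toNat_of_nonneg hb.le] at h
        have h3 : (b * t) * (a * y) = (b * t) * (b * (x - 1)) := by linear_combination h
        have h4 := mul_left_cancel₀ (by positivity) h3
        have h5 : a ∣ x - 1 := hab.dvd_of_dvd_mul_left ⟨y, h4.symm⟩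
        rw [min_eq_right (by omega)] at h1
        rw [max_eq_left (by omega)] at h2
        have := Int.le_of_dvd (by omega) h5
        omega
    have h := hstair _ _ hcons
    simp only [hp'] at h
    push_cast at h
    have e1 : (t : ℝ) / 2 * (b * (1 + a) - a * b) ^ 2 + d * (1 + a) + e * b + f -
        (t / 2 * (b * 1 - a * 0) ^ 2 + d * 1 + e * 0 + f) = d * a + e * b := by ring
    rw [e1] at h
    exact h
  obtain ⟨f0, hf0⟩ := hint 0 0
  obtain ⟨z1, hz1⟩ := hint u w
  rw [hp'] at hf0 hz1
  have hf : f = f0 := by rw [← hf0]; simp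
  rw [huwR] at hz1
  have hwb : IsCoprime w b := ⟨-a, u, by linear_combination huw⟩
  have hval : ∀ c k : ℤ, 2 * p ((c * u + k * a : ℤ) : ℝ) ((c * w + k * b : ℤ) : ℝ) =
      t * (c * (c - 1)) + 2 * (z1 - f0) * c + 2 * k * (d * a + e * b) + 2 * f0 := by
    intro c k
    rw [hp']
    push_cast
    have : (b : ℝ) * (c * u + k * a) - a * (c * w + k * b) = c := by
      linear_combination (c : ℝ) * huwR
    rw [this, hf]
    rw [hf] at hz1
    linear_combination 2 * c * hz1
  choose W hW using fun c k : ℤ => hint (c * u + k * a) (c * w + k * b)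
  have hposW : ∀ c k, 0 ≤ c * w + k * b → c * w + k * b ≤ b * t * c → 0 ≤ W c k := by
    intro c k h1 h2
    obtain ⟨j, hj⟩ := hnat _ ((hsec c k).2 ⟨h1, h2⟩)
    simp only [hW] at hj
    have : W c k = j := by exact_mod_cast hj
    omega
  have hinjW : ∀ c k c' k', 0 ≤ c * w + k * b → c * w + k * b ≤ b * t * c →
      0 ≤ c' * w + k' * b → c' * w + k' * b ≤ b * t * c' → W c k = W c' k' →
      c = c' ∧ k = k' := by
    intro c k c' k' h1 h2 h1' h2' h
    have hh := hinj ((hsec c k).2 ⟨h1, h2⟩) ((hsec c' k').2 ⟨h1', h2'⟩)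
      (by simp only [hW]; rw [h])
    have x1 : c * u + k * a = c' * u + k' * a := congrArg Prod.fst hh
    have x2 : c * w + k * b = c' * w + k' * b := congrArg Prod.snd hh
    constructor
    · linear_combination (c' - c) * huw + b * x1 - a * x2
    · linear_combination (k' - k) * huw - w * x1 + u * x2
  have hsurW : ∀ z, 0 ≤ z → ∃ c k, 0 ≤ c * w + k * b ∧ c * w + k * b ≤ b * t * c ∧
      W c k = z := by
    intro z hz
    obtain ⟨P, hP, hPz⟩ := hsur z.toNat
    obtain ⟨c, k, rfl⟩ := hpar P
    obtain ⟨h1, h2⟩ := (hsec c k).1 hP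
    refine ⟨c, k, h1, h2, ?_⟩
    simp only [hW] at hPz
    have : W c k = z.toNat := by exact_mod_cast hPz
    omega
  rcases hstep with h4 | h4
  · refine core_V w b t (z1 - f0) f0 hb ht hwb W ?_ hposW hinjW hsurW
    intro c k
    have := hval c k
    rw [hW, h4] at this
    have h' : (2 : ℝ) * W c k = t * (c * (c - 1)) + 2 * (z1 - f0) * c + 8 * k + 2 * f0 := by
      linear_combination this
    exact_mod_cast h'
  · have reg : ∀ c k : ℤ, c * w + (t * c - k) * b = b * t * c - (c * (-w) + k * b) := by
      intro c k; ring
    refine core_V (-w) b t (z1 - f0 - 4 * t) f0 hb ht hwb.neg_left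
      (fun c k => W c (t * c - k)) ?_ ?_ ?_ ?_
    · intro c k
      have := hval c (t * c - k)
      rw [hW, h4] at this
      push_cast at this
      have h' : (2 : ℝ) * W c (t * c - k) =
          t * (c * (c - 1)) + 2 * (z1 - f0 - 4 * t) * c + 8 * k + 2 * f0 := by
        linear_combination this
      exact_mod_cast h'
    · intro c k h1 h2
      have := reg c k
      exact hposW _ _ (by omega) (by omega)
    · intro c k c' k' h1 h2 h1' h2' h
      have r1 := reg c k
      have r2 := reg c' k'
      obtain ⟨x, y⟩ := hinjW _ _ _ _ (by omega) (by omega) (by omega) (by omega) h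
      subst x
      exact ⟨rfl, by omega⟩
    · intro z hz
      obtain ⟨c, k, h1, h2, h⟩ := hsurW z hz
      have r1 := reg c (t * c - k)
      have e1 : t * c - (t * c - k) = k := by ring
      rw [e1] at r1
      refine ⟨c, t * c - k, by omega, by omega, ?_⟩
      rw [e1]; exact h
end
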